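/- arXiv:1302.2043 — 2 statements merged into one kernel-verified Lean document; each statement's English description precedes it below -/
import Mathlib

section
/- For every a > 0 and b > 0 there exist constants C > 0 and ε₀ ∈ (0,1) such that the following holds. Let ε ∈ (0, ε₀], let ℓ ≥ 1 be an integer with log(1/ε) ≤ b ℓ, let w ≤ a √ℓ, and define the sieve P_{ℓ,w} := { P_{θ,g} : θ ∈ ℓ²(ℤ;ℂ), θ_k = 0 for |k| > ℓ, ‖θ‖ ≤ w, g ∈ 𝔐([0,1]) } of probability measures on ℂ^ℤ. Then log N(ε, P_{ℓ,w}, d_TV) ≤ C ℓ² ( log(1/ε) + log(ℓ+1) ), i.e. there is a finite set S of probability measures on ℂ^ℤ with log |S| ≤ C ℓ² ( log(1/ε) + log(ℓ+1) ) such that every element of P_{ℓ,w} is within total variation distance ε of some element of S. -/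
open MeasureTheory Real Set

/-- the standard complex Gaussian probability measure N_ℂ(μ,1) on ℂ,
with Lebesgue density z ↦ π⁻¹ e^{−|z−μ|²} -/
noncomputable def gaussC (μ : ℂ) : Measure ℂ :=
  volume.withDensity (fun z => ENNReal.ofReal (Real.pi⁻¹ * Real.exp (-‖z - μ‖ ^ 2)))

/-- the rotated sequence (θ•φ)_k = θ_k e^{−2iπkφ} -/
noncomputable def rotZ (θ : ℤ → ℂ) (φ : ℝ) : ℤ → ℂ :=
  fun k => θ k * Complex.exp (-Complex.I * (2 * Real.pi * (k : ℝ) * φ))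

/-- `P` is the product measure ⊗_{k∈ℤ} N_ℂ(θ_k e^{−2iπkφ}, 1) on ℂ^ℤ (product σ-algebra),
characterized as the projective limit of its finite-dimensional Gaussian product marginals. -/
def IsGaussProduct (θ : ℤ → ℂ) (φ : ℝ) (P : Measure (ℤ → ℂ)) : Prop :=
  IsProbabilityMeasure P ∧
    IsProjectiveLimit P (fun J : Finset ℤ => Measure.pi (fun k : J => gaussC (rotZ θ φ k)))

/-- g is a Borel probability measure on [0,1] (encoded as a measure on ℝ carried by [0,1]) -/
def IsProbOn01 (g : MeasureTheory.Measure ℝ) : Prop :=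
  MeasureTheory.IsProbabilityMeasure g ∧ g (Set.Icc 0 1) = 1

/-- `P` is the mixture P_{θ,g}(A) = ∫₀¹ (⊗_{k∈ℤ} N_ℂ(θ_k e^{−2iπkφ},1))(A) dg(φ) on ℂ^ℤ. -/
def IsMixtureLaw (θ : ℤ → ℂ) (g : Measure ℝ) (P : Measure (ℤ → ℂ)) : Prop :=
  ∃ Pp : ℝ → Measure (ℤ → ℂ), (∀ φ : ℝ, IsGaussProduct θ φ (Pp φ)) ∧
    ∀ A : Set (ℤ → ℂ), MeasurableSet A → P A = ∫⁻ φ, Pp φ A ∂g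

/-- Hellinger distance between two measures (computed through densities with respect to
the dominating measure P + Q; it does not depend on this choice). -/
noncomputable def dH {X : Type*} [MeasurableSpace X] (P Q : Measure X) : ℝ :=
  Real.sqrt (∫ x, (Real.sqrt ((P.rnDeriv (P + Q) x).toReal)
      - Real.sqrt ((Q.rnDeriv (P + Q) x).toReal)) ^ 2 ∂(P + Q))

/-- total variation distance between two measures: sup over measurable sets A of |P(A) − Q(A)| -/
noncomputable def dTV {X : Type*} [MeasurableSpace X] (P Q : Measure X) : ℝ :=
  ⨆ (A : Set X) (_ : MeasurableSet A), |(P A).toReal - (Q A).toReal|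

/-- the ℓ²(ℤ) norm of a sequence -/
noncomputable def l2norm (θ : ℤ → ℂ) : ℝ := Real.sqrt (∑' k : ℤ, ‖θ k‖ ^ 2)

open ProbabilityTheory

/-- the density of `N_ℂ(μ,1)` with respect to `N_ℂ(0,1)` -/
noncomputable def shiftFactor (μ z : ℂ) : ℝ :=
  Real.exp (2 * inner ℝ z μ - ‖μ‖ ^ 2)

/-- the density of `⊗ N_ℂ(v_k,1)` with respect to `⊗ N_ℂ(0,1)` when `v` is supported in `I` -/
noncomputable def shiftDensity (I : Finset ℤ) (v z : ℤ → ℂ) : ℝ :=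
  Real.exp (∑ k ∈ I, (2 * inner ℝ (z k) (v k) - ‖v k‖ ^ 2))

lemma measurable_shiftFactor (μ : ℂ) : Measurable (shiftFactor μ) := by
  unfold shiftFactor; fun_prop

lemma measurable_shiftDensity (I : Finset ℤ) (v : ℤ → ℂ) : Measurable (shiftDensity I v) := by
  unfold shiftDensity; fun_prop

lemma shiftFactor_nonneg (μ z : ℂ) : 0 ≤ shiftFactor μ z := (Real.exp_pos _).le

lemma shiftDensity_nonneg (I : Finset ℤ) (v z : ℤ → ℂ) : 0 ≤ shiftDensity I v z :=
  (Real.exp_pos _).le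

lemma gaussC_eq_withDensity (μ : ℂ) :
    gaussC μ = (gaussC 0).withDensity (fun z => ENNReal.ofReal (shiftFactor μ z)) := by
  unfold gaussC
  rw [← withDensity_mul _ (by fun_prop) (by have := measurable_shiftFactor μ; fun_prop)]
  congr 1
  ext z
  rw [Pi.mul_apply, ← ENNReal.ofReal_mul (by positivity), mul_assoc, shiftFactor, ← Real.exp_add,
    norm_sub_sq_real]
  congr 3
  simp; ring

instance isProbabilityMeasure_gaussC (μ : ℂ) : IsProbabilityMeasure (gaussC μ) := by
  constructor
  have h0 : ∫ z : ℂ, Real.exp (-‖z‖ ^ 2) = Real.pi := by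
    have := GaussianFourier.integral_rexp_neg_mul_sq_norm (V := ℂ) (b := 1) one_pos
    simpa using this
  have h1 : ∫ z : ℂ, Real.pi⁻¹ * Real.exp (-‖z - μ‖ ^ 2) = 1 := by
    rw [integral_const_mul, integral_sub_right_eq_self (fun z : ℂ => Real.exp (-‖z‖ ^ 2)) μ, h0]
    exact inv_mul_cancel₀ Real.pi_ne_zero
  rw [gaussC, withDensity_apply _ MeasurableSet.univ, Measure.restrict_univ,
    ← ofReal_integral_eq_lintegral_ofReal _ (ae_of_all _ fun _ => by positivity), h1,
    ENNReal.ofReal_one]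
  by_contra h
  rw [integral_undef h] at h1
  exact zero_ne_one h1

/-- the law of a centred standard complex Gaussian sequence -/
noncomputable def gaussSeq : Measure (ℤ → ℂ) := Measure.infinitePi (fun _ : ℤ => gaussC 0)

instance : IsProbabilityMeasure gaussSeq := by unfold gaussSeq; infer_instance

lemma shiftDensity_eq_prod (I : Finset ℤ) (v z : ℤ → ℂ) :
    shiftDensity I v z = ∏ k ∈ I, shiftFactor (v k) (z k) := by
  unfold shiftDensity shiftFactor
  rw [Real.exp_sum]

lemma lintegral_gaussSeq_prod (s : Finset ℤ) (h : ℤ → ℂ → ENNReal) (hm : ∀ k, Measurable (h k)) :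
    ∫⁻ z, ∏ k ∈ s, h k (z k) ∂gaussSeq = ∏ k ∈ s, ∫⁻ x, h k x ∂(gaussC 0) := by
  have h1 := lintegral_prod_eq_prod_lintegral_of_indepFun s (fun k (z : ℤ → ℂ) => h k (z k))
    (iIndepFun_infinitePi (P := fun _ : ℤ => gaussC 0) hm)
    (fun k => (hm k).comp (measurable_pi_apply k))
  unfold gaussSeq
  rw [h1]
  refine Finset.prod_congr rfl fun k _ => ?_
  rw [← lintegral_map (hm k) (measurable_pi_apply k)]
  congr 1
  exact Measure.infinitePi_map_eval (fun _ : ℤ => gaussC 0) k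

lemma infinitePi_gaussC_eq_withDensity (I : Finset ℤ) (v : ℤ → ℂ) (hv : ∀ k ∉ I, v k = 0) :
    Measure.infinitePi (fun k : ℤ => gaussC (v k)) =
      gaussSeq.withDensity (fun z => ENNReal.ofReal (shiftDensity I v z)) := by
  classical
  symm
  refine Measure.eq_infinitePi _ fun s t ht => ?_
  have hst : MeasurableSet (Set.pi (s : Set ℤ) t) :=
    MeasurableSet.pi s.countable_toSet fun i _ => ht i
  set T : ℤ → Set ℂ := fun k => if k ∈ s then t k else Set.univ with hT
  have hTm : ∀ k, MeasurableSet (T k) := fun k => by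
    simp only [hT]; split_ifs
    · exact ht k
    · exact .univ
  have hfm : ∀ k, Measurable fun x => ENNReal.ofReal (shiftFactor (v k) x) := fun k =>
    (measurable_shiftFactor _).ennreal_ofReal
  rw [withDensity_apply _ hst, ← lintegral_indicator hst]
  have key : ∀ z : ℤ → ℂ, (Set.pi (s : Set ℤ) t).indicator
      (fun z => ENNReal.ofReal (shiftDensity I v z)) z =
      ∏ k ∈ I ∪ s, (T k).indicator (fun x => ENNReal.ofReal (shiftFactor (v k) x)) (z k) := by
    intro z
    by_cases hz : z ∈ Set.pi (s : Set ℤ) t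
    · rw [Set.indicator_of_mem hz, shiftDensity_eq_prod,
        ENNReal.ofReal_prod_of_nonneg fun _ _ => shiftFactor_nonneg _ _,
        Finset.prod_subset (Finset.subset_union_left (s₂ := s))]
      · refine Finset.prod_congr rfl fun k _ => ?_
        rw [Set.indicator_of_mem]
        simp only [hT]
        split_ifs with hk
        · exact hz k hk
        · trivial
      · intro k _ hk
        simp [hv k hk, shiftFactor]
    · rw [Set.indicator_of_notMem hz]
      simp only [Set.mem_pi, not_forall] at hz
      obtain ⟨k, hk, hkt⟩ := hz
      symm
      refine Finset.prod_eq_zero (i := k) (Finset.mem_union_right _ (by simpa using hk)) ?_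
      rw [Set.indicator_of_notMem]
      have : k ∈ s := by simpa using hk
      simpa [hT, this] using hkt
  simp_rw [key]
  rw [lintegral_gaussSeq_prod _ _ fun k => (hfm k).indicator (hTm k)]
  have h2 : ∀ k, ∫⁻ x, (T k).indicator (fun x => ENNReal.ofReal (shiftFactor (v k) x)) x
      ∂(gaussC 0) = gaussC (v k) (T k) := fun k => by
    rw [lintegral_indicator (hTm k), gaussC_eq_withDensity (v k), withDensity_apply _ (hTm k)]
  simp_rw [h2]
  rw [← Finset.prod_subset (Finset.subset_union_right (s₁ := I))]
  · refine Finset.prod_congr rfl fun k hk => ?_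
    simp [hT, hk]
  · intro k _ hk
    simp [hT, hk]

lemma lintegral_shiftDensity (I : Finset ℤ) (v : ℤ → ℂ) :
    ∫⁻ z, ENNReal.ofReal (shiftDensity I v z) ∂gaussSeq = 1 := by
  classical
  simp_rw [shiftDensity_eq_prod, ENNReal.ofReal_prod_of_nonneg fun _ _ => shiftFactor_nonneg _ _]
  rw [lintegral_gaussSeq_prod _ _ fun k => (measurable_shiftFactor (v k)).ennreal_ofReal]
  refine Finset.prod_eq_one fun k _ => ?_
  have := measure_univ (μ := gaussC (v k))
  rwa [gaussC_eq_withDensity, withDensity_apply _ .univ, Measure.restrict_univ] at this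

lemma integrable_shiftDensity (I : Finset ℤ) (v : ℤ → ℂ) :
    Integrable (shiftDensity I v) gaussSeq := by
  refine ⟨(measurable_shiftDensity I v).aestronglyMeasurable, ?_⟩
  rw [hasFiniteIntegral_iff_ofReal (ae_of_all _ fun _ => shiftDensity_nonneg _ _ _),
    lintegral_shiftDensity]
  exact ENNReal.one_lt_top

lemma integral_shiftDensity (I : Finset ℤ) (v : ℤ → ℂ) :
    ∫ z, shiftDensity I v z ∂gaussSeq = 1 := by
  rw [integral_eq_lintegral_of_nonneg_ae (ae_of_all _ fun _ => shiftDensity_nonneg _ _ _)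
    (measurable_shiftDensity I v).aestronglyMeasurable, lintegral_shiftDensity, ENNReal.toReal_one]

lemma IsGaussProduct.apply_eq {θ : ℤ → ℂ} {φ : ℝ} {P : Measure (ℤ → ℂ)} (h : IsGaussProduct θ φ P)
    (I : Finset ℤ) (hθ : ∀ k ∉ I, θ k = 0) {A : Set (ℤ → ℂ)} (hA : MeasurableSet A) :
    P A = ENNReal.ofReal (∫ z in A, shiftDensity I (rotZ θ φ) z ∂gaussSeq) := by
  have h1 : P = Measure.infinitePi (fun k : ℤ => gaussC (rotZ θ φ k)) :=
    h.2.unique (Measure.isProjectiveLimit_infinitePi _)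
  rw [h1, infinitePi_gaussC_eq_withDensity I _ fun k hk => by simp [rotZ, hθ k hk],
    withDensity_apply _ hA, ofReal_integral_eq_lintegral_ofReal
      (integrable_shiftDensity _ _).integrableOn (ae_of_all _ fun _ => shiftDensity_nonneg _ _ _)]

lemma shiftDensity_mul (I : Finset ℤ) (u v z : ℤ → ℂ) :
    shiftDensity I u z * shiftDensity I v z =
      Real.exp (2 * ∑ k ∈ I, inner ℝ (u k) (v k)) * shiftDensity I (fun k => u k + v k) z := by
  unfold shiftDensity
  rw [← Real.exp_add, ← Real.exp_add, Finset.mul_sum, ← Finset.sum_add_distrib,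
    ← Finset.sum_add_distrib]
  congr 1
  refine Finset.sum_congr rfl fun k _ => ?_
  rw [norm_add_sq_real, inner_add_right]
  ring

lemma shiftDensity_mul_eq_sq_midpoint (I : Finset ℤ) (u v z : ℤ → ℂ) :
    shiftDensity I u z * shiftDensity I v z =
      (Real.exp (-(∑ k ∈ I, ‖u k - v k‖ ^ 2) / 4) *
        shiftDensity I (fun k => (1 / 2 : ℝ) • (u k + v k)) z) ^ 2 := by
  unfold shiftDensity
  rw [← Real.exp_add, ← Real.exp_add, ← Real.exp_nat_mul, ← Finset.sum_add_distrib,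
    ← Finset.sum_neg_distrib, Finset.sum_div, ← Finset.sum_add_distrib, Finset.mul_sum]
  congr 1
  refine Finset.sum_congr rfl fun k _ => ?_
  rw [norm_smul, mul_pow, norm_add_sq_real, inner_smul_right, inner_add_right, norm_sub_sq_real]
  norm_num
  ring

lemma abs_setIntegral_le_of_integral_sq_le {Ω : Type*} [MeasurableSpace Ω] {μ : Measure Ω}
    [IsProbabilityMeasure μ] {f : Ω → ℝ} (hf : Integrable f μ)
    (hf2 : Integrable (fun x => f x ^ 2) μ) {d : ℝ} (hd : 0 < d)
    (h : ∫ x, f x ^ 2 ∂μ ≤ d ^ 2) (A : Set Ω) : |∫ x in A, f x ∂μ| ≤ d := by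
  calc |∫ x in A, f x ∂μ| ≤ ∫ x in A, |f x| ∂μ := abs_integral_le_integral_abs
    _ ≤ ∫ x, |f x| ∂μ := setIntegral_le_integral hf.abs (ae_of_all _ fun _ => abs_nonneg _)
    _ ≤ ∫ x, (d / 2 + f x ^ 2 / (2 * d)) ∂μ := by
        refine integral_mono hf.abs ((integrable_const _).add (hf2.div_const _)) fun x => ?_
        have h1 : d / 2 + f x ^ 2 / (2 * d) - |f x| = (|f x| - d) ^ 2 / (2 * d) := by
          rw [← sq_abs (f x)]; field_simp; ring
        have h2 : 0 ≤ (|f x| - d) ^ 2 / (2 * d) := by positivity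
        simp only
        linarith
    _ = d / 2 + (∫ x, f x ^ 2 ∂μ) / (2 * d) := by
        rw [integral_add (integrable_const _) (hf2.div_const _), integral_div (2 * d)]; simp
    _ ≤ d / 2 + d ^ 2 / (2 * d) := by gcongr
    _ = d := by field_simp; ring

lemma abs_sum_setIntegral_shiftDensity_le {ι : Type*} [Fintype ι] (I : Finset ℤ) (c : ι → ℝ)
    (v : ι → ℤ → ℂ) {d : ℝ} (hd : 0 < d)
    (h : ∑ i, c i * ∑ j, c j * Real.exp (2 * ∑ k ∈ I, inner ℝ (v j k) (v i k)) ≤ d ^ 2)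
    (A : Set (ℤ → ℂ)) :
    |∑ i, c i * ∫ z in A, shiftDensity I (v i) z ∂gaussSeq| ≤ d := by
  have hf : Integrable (fun z => ∑ i, c i * shiftDensity I (v i) z) gaussSeq :=
    integrable_finsetSum _ fun i _ => (integrable_shiftDensity I (v i)).const_mul _
  have hsq : ∀ z, (∑ i, c i * shiftDensity I (v i) z) ^ 2 =
      ∑ i, c i * ∑ j, c j * (Real.exp (2 * ∑ k ∈ I, inner ℝ (v j k) (v i k)) *
        shiftDensity I (fun k => v j k + v i k) z) := fun z => by
    rw [sq, Finset.sum_mul]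
    refine Finset.sum_congr rfl fun i _ => ?_
    rw [mul_assoc, Finset.mul_sum]
    congr 1
    refine Finset.sum_congr rfl fun j _ => ?_
    rw [← shiftDensity_mul]; ring
  have hi : ∀ i j, Integrable (fun z => c j * (Real.exp (2 * ∑ k ∈ I, inner ℝ (v j k) (v i k)) *
        shiftDensity I (fun k => v j k + v i k) z)) gaussSeq := fun i j =>
    ((integrable_shiftDensity I _).const_mul _).const_mul _
  have hi2 : ∀ i, Integrable (fun z => c i * ∑ j, c j *
      (Real.exp (2 * ∑ k ∈ I, inner ℝ (v j k) (v i k)) *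
        shiftDensity I (fun k => v j k + v i k) z)) gaussSeq := fun i =>
    (integrable_finsetSum _ fun j _ => hi i j).const_mul _
  have hmain := abs_setIntegral_le_of_integral_sq_le hf
    (by simp_rw [hsq]; exact integrable_finsetSum _ fun i _ => hi2 i) hd (by
      simp_rw [hsq]
      rw [integral_finsetSum _ fun i _ => hi2 i]
      refine le_of_eq_of_le ?_ h
      refine Finset.sum_congr rfl fun i _ => ?_
      rw [integral_const_mul, integral_finsetSum _ fun j _ => hi i j]
      congr 1
      refine Finset.sum_congr rfl fun j _ => ?_
      rw [integral_const_mul, integral_const_mul, integral_shiftDensity, mul_one]) A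
  rw [integral_finsetSum _ fun i _ =>
    ((integrable_shiftDensity I (v i)).const_mul _).integrableOn] at hmain
  simpa only [integral_const_mul] using hmain

lemma abs_setIntegral_shiftDensity_sub_le (I : Finset ℤ) (u v : ℤ → ℂ) {d : ℝ} (hd : 0 < d)
    (h : ∑ k ∈ I, ‖u k - v k‖ ^ 2 ≤ d ^ 2) (A : Set (ℤ → ℂ)) :
    |(∫ z in A, shiftDensity I u z ∂gaussSeq) - ∫ z in A, shiftDensity I v z ∂gaussSeq|
      ≤ 3 * d := by
  have hu := integrable_shiftDensity I u
  have hv := integrable_shiftDensity I v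
  set e : ℝ := Real.exp (-(∑ k ∈ I, ‖u k - v k‖ ^ 2) / 4) with he
  have he1 : 1 - d ^ 2 / 4 ≤ e := by
    have := Real.add_one_le_exp (-(∑ k ∈ I, ‖u k - v k‖ ^ 2) / 4)
    linarith
  have he2 : e ≤ 1 := by
    rw [he, Real.exp_le_one_iff]
    have : 0 ≤ ∑ k ∈ I, ‖u k - v k‖ ^ 2 := Finset.sum_nonneg fun _ _ => by positivity
    linarith
  set w : ℤ → ℂ := fun k => (1 / 2 : ℝ) • (u k + v k) with hw
  have hwi := (integrable_shiftDensity I w).const_mul e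
  have huv : Integrable (fun z => shiftDensity I u z + shiftDensity I v z) gaussSeq := hu.add hv
  have hp : Integrable (fun z => (shiftDensity I u z + shiftDensity I v z) -
      2 * (e * shiftDensity I w z)) gaussSeq := huv.sub (hwi.const_mul 2)
  have hq : Integrable (fun z => (shiftDensity I u z + shiftDensity I v z) +
      2 * (e * shiftDensity I w z)) gaussSeq := huv.add (hwi.const_mul 2)
  have hint : ∫ z, (((shiftDensity I u z + shiftDensity I v z) - 2 * (e * shiftDensity I w z)) / d +
      d * ((shiftDensity I u z + shiftDensity I v z) + 2 * (e * shiftDensity I w z))) / 2 ∂gaussSeq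
      = ((2 - 2 * e) / d + d * (2 + 2 * e)) / 2 := by
    rw [integral_div, integral_add (hp.div_const d) (hq.const_mul d), integral_div,
      integral_const_mul, integral_sub huv (hwi.const_mul 2),
      integral_add huv (hwi.const_mul 2), integral_add hu hv, integral_const_mul,
      integral_const_mul, integral_shiftDensity, integral_shiftDensity, integral_shiftDensity]
    ring
  rw [← integral_sub hu.integrableOn hv.integrableOn]
  calc |∫ z in A, (shiftDensity I u z - shiftDensity I v z) ∂gaussSeq|
      ≤ ∫ z in A, |shiftDensity I u z - shiftDensity I v z| ∂gaussSeq :=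
        abs_integral_le_integral_abs
    _ ≤ ∫ z, |shiftDensity I u z - shiftDensity I v z| ∂gaussSeq :=
        setIntegral_le_integral (hu.sub hv).abs (ae_of_all _ fun _ => abs_nonneg _)
    _ ≤ ((2 - 2 * e) / d + d * (2 + 2 * e)) / 2 := by
        rw [← hint]
        refine integral_mono (hu.sub hv).abs (((hp.div_const d).add (hq.const_mul d)).div_const 2)
          fun z => ?_
        have h1 := shiftDensity_mul_eq_sq_midpoint I u v z
        rw [← he, ← hw] at h1
        have hx := shiftDensity_nonneg I u z
        have hy := shiftDensity_nonneg I v z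
        have hg : 0 ≤ e * shiftDensity I w z :=
          mul_nonneg (Real.exp_pos _).le (shiftDensity_nonneg _ _ _)
        simp only
        generalize shiftDensity I u z = x at *
        generalize shiftDensity I v z = y at *
        generalize e * shiftDensity I w z = g at *
        have h2 : 0 ≤ x + y - 2 * g := by nlinarith [sq_nonneg (x - y)]
        refine abs_le_of_sq_le_sq ?_ (by positivity)
        have h3 : (x - y) ^ 2 = (x + y - 2 * g) / d * (d * (x + y + 2 * g)) := by
          field_simp; nlinarith
        rw [h3]
        nlinarith [sq_nonneg ((x + y - 2 * g) / d - d * (x + y + 2 * g))]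
    _ ≤ ((d ^ 2 / 2) / d + d * 4) / 2 := by gcongr <;> linarith
    _ ≤ 3 * d := by
        have : d ^ 2 / 2 / d = d / 2 := by field_simp
        rw [this]; linarith

lemma inner_rotZ (θ : ℤ → ℂ) (φ ψ : ℝ) (k : ℤ) :
    inner ℝ (rotZ θ φ k) (rotZ θ ψ k) = ‖θ k‖ ^ 2 * Real.cos (2 * Real.pi * k * (φ - ψ)) := by
  have h : ∀ x : ℝ, Complex.exp (-Complex.I * (2 * Real.pi * (k : ℝ) * x)) =
      ⟨Real.cos (2 * Real.pi * k * x), -Real.sin (2 * Real.pi * k * x)⟩ := fun x => by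
    have : -Complex.I * (2 * Real.pi * (k : ℝ) * x) =
        ((-(2 * Real.pi * k * x) : ℝ) : ℂ) * Complex.I := by push_cast; ring
    rw [this]
    apply Complex.ext
    · rw [Complex.exp_ofReal_mul_I_re, Real.cos_neg]
    · rw [Complex.exp_ofReal_mul_I_im, Real.sin_neg]
  rw [rotZ, rotZ, h, h, Complex.inner, mul_sub, Real.cos_sub, ← Complex.normSq_eq_norm_sq,
    Complex.normSq_apply]
  simp only [Complex.mul_re, Complex.mul_im, Complex.conj_re, Complex.conj_im]
  ring

lemma norm_rotZ (θ : ℤ → ℂ) (φ : ℝ) (k : ℤ) : ‖rotZ θ φ k‖ = ‖θ k‖ := by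
  have h := inner_rotZ θ φ φ k
  rw [real_inner_self_eq_norm_sq, sub_self, mul_zero, Real.cos_zero, mul_one] at h
  exact (pow_left_inj₀ (norm_nonneg _) (norm_nonneg _) two_ne_zero).1 h

lemma norm_rotZ_sub_rotZ_sq_le (θ : ℤ → ℂ) (φ ψ : ℝ) (k : ℤ) :
    ‖rotZ θ φ k - rotZ θ ψ k‖ ^ 2 ≤ ‖θ k‖ ^ 2 * (2 * Real.pi * k * (φ - ψ)) ^ 2 := by
  rw [norm_sub_sq_real, norm_rotZ, norm_rotZ, inner_rotZ]
  have h := Real.one_sub_sq_div_two_le_cos (x := 2 * Real.pi * k * (φ - ψ))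
  nlinarith [sq_nonneg ‖θ k‖]

lemma norm_rotZ_sub_rotZ (θ η : ℤ → ℂ) (φ : ℝ) (k : ℤ) :
    ‖rotZ θ φ k - rotZ η φ k‖ = ‖θ k - η k‖ := by
  rw [← norm_rotZ (fun k => θ k - η k) φ k]
  simp only [rotZ]
  rw [sub_mul]

lemma abs_exp_sub_sum_le {t x : ℝ} (ht : |t| ≤ x) (J : ℕ) :
    |Real.exp t - ∑ j ∈ Finset.range J, t ^ j / (j.factorial : ℝ)|
      ≤ Real.exp (Real.exp 1 * x - J) := by
  have hx : 0 ≤ x := (abs_nonneg t).trans ht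
  have hs : ∀ y : ℝ, HasSum (fun j : ℕ => y ^ j / (j.factorial : ℝ)) (Real.exp y) := fun y => by
    rw [Real.exp_eq_exp_ℝ]
    exact NormedSpace.expSeries_div_hasSum_exp y
  have h1 : Real.exp t - ∑ j ∈ Finset.range J, t ^ j / (j.factorial : ℝ) =
      ∑' j, t ^ (j + J) / ((j + J).factorial : ℝ) := by
    rw [← (hs t).tsum_eq, ← (hs t).summable.sum_add_tsum_nat_add J]; ring
  have hS : Summable fun j : ℕ => (Real.exp 1 * x) ^ (j + J) / ((j + J).factorial : ℝ) :=
    (summable_nat_add_iff J).2 (hs _).summable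
  have h2 : ∑' j, (Real.exp 1 * x) ^ (j + J) / ((j + J).factorial : ℝ) ≤
      Real.exp (Real.exp 1 * x) := by
    rw [← (hs (Real.exp 1 * x)).tsum_eq, ← (hs (Real.exp 1 * x)).summable.sum_add_tsum_nat_add J]
    exact le_add_of_nonneg_left (Finset.sum_nonneg fun _ _ => by positivity)
  have hb : ∀ j : ℕ, ‖t ^ (j + J) / ((j + J).factorial : ℝ)‖ ≤
      Real.exp (-J) * ((Real.exp 1 * x) ^ (j + J) / ((j + J).factorial : ℝ)) := fun j => by
    rw [norm_div, norm_pow, Real.norm_eq_abs, Real.norm_natCast, mul_div_assoc']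
    gcongr
    have h3 : (1 : ℝ) ≤ Real.exp (-J) * Real.exp 1 ^ (j + J) := by
      rw [← Real.exp_nat_mul, ← Real.exp_add]
      apply Real.one_le_exp
      push_cast
      linarith [(Nat.cast_nonneg j : (0 : ℝ) ≤ j)]
    calc |t| ^ (j + J) ≤ x ^ (j + J) := by gcongr
      _ ≤ Real.exp (-J) * Real.exp 1 ^ (j + J) * x ^ (j + J) :=
        le_mul_of_one_le_left (by positivity) h3
      _ = _ := by rw [mul_pow]; ring
  rw [h1, ← Real.norm_eq_abs, sub_eq_neg_add, Real.exp_add]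
  refine (tsum_of_norm_bounded (hS.mul_left _).hasSum hb).trans ?_
  rw [tsum_mul_left]
  gcongr

lemma sum_mul_cos_mul_pow_eq_zero {ι : Type*} [Fintype ι] (c φ : ι → ℝ) (M ℓ : ℕ)
    (H : ∀ m : ℤ, |m| ≤ M → ∀ τ : ℝ, ∑ i, c i * Real.cos (2 * Real.pi * m * φ i + τ) = 0)
    (ρ : ℤ → ℝ) (ψ : ℝ) (j : ℕ) :
    ∀ m : ℤ, |m| + j * ℓ ≤ M → ∀ τ : ℝ, ∑ i, c i * (Real.cos (2 * Real.pi * m * φ i + τ) *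
      (2 * ∑ k ∈ Finset.Icc (-(ℓ : ℤ)) ℓ, ρ k * Real.cos (2 * Real.pi * k * (φ i - ψ))) ^ j)
        = 0 := by
  induction j with
  | zero =>
    intro m hm τ
    simpa using H m (by simpa using hm) τ
  | succ j ih =>
    intro m hm τ
    have hstep : ∀ i, c i * (Real.cos (2 * Real.pi * m * φ i + τ) *
        (2 * ∑ k ∈ Finset.Icc (-(ℓ : ℤ)) ℓ, ρ k * Real.cos (2 * Real.pi * k * (φ i - ψ))) ^ (j + 1))
        = ∑ k ∈ Finset.Icc (-(ℓ : ℤ)) ℓ, ρ k *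
          (c i * (Real.cos (2 * Real.pi * (m + k : ℤ) * φ i + (τ - 2 * Real.pi * k * ψ)) *
            (2 * ∑ k ∈ Finset.Icc (-(ℓ : ℤ)) ℓ, ρ k * Real.cos (2 * Real.pi * k * (φ i - ψ))) ^ j) +
          c i * (Real.cos (2 * Real.pi * (m - k : ℤ) * φ i + (τ + 2 * Real.pi * k * ψ)) *
            (2 * ∑ k ∈ Finset.Icc (-(ℓ : ℤ)) ℓ, ρ k * Real.cos (2 * Real.pi * k * (φ i - ψ))) ^ j))
        := fun i => by
      rw [pow_succ]
      generalize (2 * ∑ k ∈ Finset.Icc (-(ℓ : ℤ)) ℓ,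
        ρ k * Real.cos (2 * Real.pi * k * (φ i - ψ))) ^ j = F
      rw [Finset.mul_sum, Finset.mul_sum, Finset.mul_sum, Finset.mul_sum]
      refine Finset.sum_congr rfl fun k _ => ?_
      have e1 : 2 * Real.pi * (m + k : ℤ) * φ i + (τ - 2 * Real.pi * k * ψ) =
          (2 * Real.pi * m * φ i + τ) + 2 * Real.pi * k * (φ i - ψ) := by push_cast; ring
      have e2 : 2 * Real.pi * (m - k : ℤ) * φ i + (τ + 2 * Real.pi * k * ψ) =
          (2 * Real.pi * m * φ i + τ) - 2 * Real.pi * k * (φ i - ψ) := by push_cast; ring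
      rw [e1, e2, Real.cos_add (2 * Real.pi * m * φ i + τ), Real.cos_sub (2 * Real.pi * m * φ i + τ)]
      ring
    simp_rw [hstep]
    rw [Finset.sum_comm]
    refine Finset.sum_eq_zero fun k hk => ?_
    rw [← Finset.mul_sum, Finset.sum_add_distrib]
    have hk' : |k| ≤ ℓ := abs_le.2 (Finset.mem_Icc.1 hk)
    have hm' : |m| + (j * ℓ + ℓ) ≤ M := by push_cast at hm; linarith
    rw [ih (m + k) (by linarith [abs_add_le m k]), ih (m - k) (by linarith [abs_sub m k])]
    simp

lemma abs_sum_setIntegral_rotZ_le {ι : Type*} [Fintype ι] (c φ : ι → ℝ) (ℓ J : ℕ)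
    (H : ∀ m : ℤ, |m| ≤ (J * ℓ : ℕ) → ∀ τ : ℝ,
      ∑ i, c i * Real.cos (2 * Real.pi * m * φ i + τ) = 0)
    (hc : ∑ i, |c i| ≤ 2) (θ : ℤ → ℂ) {x d : ℝ} (hd : 0 < d)
    (hθ : 2 * ∑ k ∈ Finset.Icc (-(ℓ : ℤ)) ℓ, ‖θ k‖ ^ 2 ≤ x)
    (hx : 4 * Real.exp (Real.exp 1 * x - J) ≤ d ^ 2) (A : Set (ℤ → ℂ)) :
    |∑ i, c i * ∫ z in A, shiftDensity (Finset.Icc (-(ℓ : ℤ)) ℓ) (rotZ θ (φ i)) z ∂gaussSeq|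
      ≤ d := by
  refine abs_sum_setIntegral_shiftDensity_le _ c _ hd ?_ A
  simp_rw [inner_rotZ]
  set t : ι → ι → ℝ := fun j i => 2 * ∑ k ∈ Finset.Icc (-(ℓ : ℤ)) ℓ,
    ‖θ k‖ ^ 2 * Real.cos (2 * Real.pi * k * (φ j - φ i)) with ht
  have hpow : ∀ i, ∀ n < J, ∑ j, c j * t j i ^ n = 0 := fun i n hn => by
    have := sum_mul_cos_mul_pow_eq_zero c φ (J * ℓ) ℓ H (fun k => ‖θ k‖ ^ 2) (φ i) n 0
      (by simpa using by exact_mod_cast Nat.mul_le_mul_right ℓ hn.le) 0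
    simpa using this
  have htx : ∀ j i, |t j i| ≤ x := fun j i => by
    refine le_trans ?_ hθ
    rw [ht, abs_mul, abs_two]
    gcongr
    refine (Finset.abs_sum_le_sum_abs _ _).trans (Finset.sum_le_sum fun k _ => ?_)
    rw [abs_mul, abs_of_nonneg (by positivity : 0 ≤ ‖θ k‖ ^ 2)]
    exact mul_le_of_le_one_right (by positivity) (Real.abs_cos_le_one _)
  have hrem : ∀ i, ∑ j, c j * Real.exp (t j i) = ∑ j, c j * (Real.exp (t j i) -
      ∑ n ∈ Finset.range J, t j i ^ n / (n.factorial : ℝ)) := fun i => by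
    simp_rw [mul_sub, Finset.sum_sub_distrib, Finset.mul_sum]
    rw [Finset.sum_comm, Finset.sum_eq_zero (s := Finset.range J), sub_zero]
    intro n hn
    simp_rw [mul_div_assoc', ← Finset.sum_div, hpow i n (Finset.mem_range.1 hn), zero_div]
  have hbd : ∀ i, |∑ j, c j * Real.exp (t j i)| ≤ 2 * Real.exp (Real.exp 1 * x - J) := fun i => by
    rw [hrem]
    calc _ ≤ ∑ j, |c j| * Real.exp (Real.exp 1 * x - J) := by
          refine (Finset.abs_sum_le_sum_abs _ _).trans (Finset.sum_le_sum fun j _ => ?_)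
          rw [abs_mul]
          gcongr
          exact abs_exp_sub_sum_le (htx j i) J
      _ ≤ _ := by rw [← Finset.sum_mul]; gcongr
  calc ∑ i, c i * ∑ j, c j * Real.exp (t j i)
      ≤ ∑ i, |c i| * (2 * Real.exp (Real.exp 1 * x - J)) := by
        refine Finset.sum_le_sum fun i _ => (le_abs_self _).trans ?_
        rw [abs_mul]
        gcongr
        exact hbd i
    _ ≤ 2 * (2 * Real.exp (Real.exp 1 * x - J)) := by rw [← Finset.sum_mul]; gcongr
    _ ≤ d ^ 2 := by linarith

lemma exists_sparse_weights {ι κ : Type} [Fintype ι] [Fintype κ] (Φ : ι → κ → ℝ) (w : ι → ℝ)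
    (hw : ∀ i, 0 ≤ w i) (hw1 : ∑ i, w i = 1) {n : ℕ} (hn : Fintype.card κ + 1 = n) :
    ∃ (a : Fin n → ι) (v : Fin n → ℝ), (∀ s, 0 ≤ v s) ∧ ∑ s, v s = 1 ∧
      ∀ k, ∑ s, v s * Φ (a s) k = ∑ i, w i * Φ i k := by
  classical
  have hmem : ∑ i, w i • Φ i ∈ convexHull ℝ (Set.range Φ) :=
    (convex_convexHull ℝ _).sum_mem (fun i _ => hw i) hw1
      fun i _ => subset_convexHull ℝ _ (Set.mem_range_self i)
  obtain ⟨σ, _, z, v, hz, hai, hv, hv1, hvz⟩ := eq_pos_convex_span_of_mem_convexHull hmem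
  have hcard : Fintype.card σ ≤ n := by
    have h1 := hai.card_le_finrank_succ
    have h2 := Submodule.finrank_le (vectorSpan ℝ (Set.range z))
    rw [Module.finrank_fintype_fun_eq_card] at h2
    omega
  obtain ⟨f⟩ : Nonempty (σ ↪ Fin n) := Function.Embedding.nonempty_of_card_le (by simpa using hcard)
  choose b hb using fun s => hz (Set.mem_range_self s)
  have hne : Nonempty ι := by
    by_contra h
    rw [not_nonempty_iff] at h
    simp at hw1
  have hext : ∀ g : ι → ℝ, ∑ s, Function.extend f v 0 s *
      g (Function.extend f b (fun _ => hne.some) s) = ∑ s, v s * g (b s) := fun g => by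
    rw [← Finset.sum_subset (Finset.subset_univ (Finset.univ.map f)), Finset.sum_map]
    · simp [f.injective.extend_apply]
    · intro s _ hs
      rw [Function.extend_apply' _ _ _ (by simpa using hs)]
      simp
  refine ⟨Function.extend f b (fun _ => hne.some), Function.extend f v 0, fun s => ?_, ?_,
    fun k => ?_⟩
  · by_cases h : ∃ i, f i = s
    · obtain ⟨i, rfl⟩ := h
      rw [f.injective.extend_apply]
      exact (hv i).le
    · rw [Function.extend_apply' _ _ _ h]; rfl
  · simpa [hv1] using hext fun _ => 1
  · rw [hext fun i => Φ i k]
    have := congrFun hvz k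
    simpa [hb] using this

lemma exists_sparse_trig_weights {ι : Type} [Fintype ι] (φ w : ι → ℝ)
    (hw : ∀ i, 0 ≤ w i) (hw1 : ∑ i, w i = 1) (M : ℕ) :
    ∃ (a : Fin (2 * M + 3) → ι) (v : Fin (2 * M + 3) → ℝ), (∀ s, 0 ≤ v s) ∧ ∑ s, v s = 1 ∧
      ∀ m : ℤ, |m| ≤ M → ∀ τ : ℝ, ∑ s, v s * Real.cos (2 * Real.pi * m * φ (a s) + τ) =
        ∑ i, w i * Real.cos (2 * Real.pi * m * φ i + τ) := by
  obtain ⟨a, v, hv, hv1, h⟩ := exists_sparse_weights (κ := Fin (M + 1) × Bool)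
    (fun i p => if p.2 then Real.cos (2 * Real.pi * (p.1 : ℕ) * φ i)
      else Real.sin (2 * Real.pi * (p.1 : ℕ) * φ i)) w hw hw1 (n := 2 * M + 3) (by simp; ring)
  refine ⟨a, v, hv, hv1, ?_⟩
  have hnat : ∀ m : ℕ, m ≤ M → ∀ τ : ℝ,
      ∑ s, v s * Real.cos (2 * Real.pi * m * φ (a s) + τ) =
        ∑ i, w i * Real.cos (2 * Real.pi * m * φ i + τ) := fun m hm τ => by
    have hcos := h (⟨m, by omega⟩, true)
    have hsin := h (⟨m, by omega⟩, false)
    simp only [if_true, Bool.false_eq_true, if_false] at hcos hsin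
    simp_rw [Real.cos_add, mul_sub, ← mul_assoc, Finset.sum_sub_distrib, ← Finset.sum_mul]
    rw [hcos, hsin]
  intro m hm τ
  obtain ⟨n, rfl | rfl⟩ := m.eq_nat_or_neg
  · simpa using hnat n (by simpa using hm) τ
  · have := hnat n (by simpa using hm) (-τ)
    have e : ∀ x : ℝ, Real.cos (2 * Real.pi * n * x + -τ) =
        Real.cos (2 * Real.pi * ((-(n : ℤ) : ℤ) : ℝ) * x + τ) := fun x => by
      rw [← Real.cos_neg]; congr 1; push_cast; ring
    simpa only [e] using this

lemma setIntegral_shiftDensity_nonneg (I : Finset ℤ) (v : ℤ → ℂ) (A : Set (ℤ → ℂ)) :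
    0 ≤ ∫ z in A, shiftDensity I v z ∂gaussSeq :=
  integral_nonneg fun z => shiftDensity_nonneg I v z

lemma setIntegral_shiftDensity_le_one (I : Finset ℤ) (v : ℤ → ℂ) (A : Set (ℤ → ℂ)) :
    ∫ z in A, shiftDensity I v z ∂gaussSeq ≤ 1 := by
  rw [← integral_shiftDensity I v]
  exact setIntegral_le_integral (integrable_shiftDensity I v)
    (ae_of_all _ fun _ => shiftDensity_nonneg _ _ _)

lemma IsMixtureLaw.isProbabilityMeasure {θ : ℤ → ℂ} {g : Measure ℝ} {P : Measure (ℤ → ℂ)}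
    (hP : IsMixtureLaw θ g P) (hg : IsProbOn01 g) : IsProbabilityMeasure P := by
  obtain ⟨Pp, hPp, hPA⟩ := hP
  have := hg.1
  constructor
  rw [hPA _ .univ]
  have : ∀ φ, Pp φ Set.univ = 1 := fun φ => (hPp φ).1.measure_univ
  simp [this]

lemma exists_weights_on_grid {θ : ℤ → ℂ} {g : Measure ℝ} {P : Measure (ℤ → ℂ)}
    (hP : IsMixtureLaw θ g P) (hg : IsProbOn01 g) {ℓ : ℕ}
    (hθ : ∀ k ∉ Finset.Icc (-(ℓ : ℤ)) ℓ, θ k = 0) {B : ℝ}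
    (hB : ∑ k ∈ Finset.Icc (-(ℓ : ℤ)) ℓ, ‖θ k‖ ^ 2 ≤ B) {G : ℕ} (hG : 1 ≤ G) {d : ℝ} (hd : 0 < d)
    (hBd : B * (2 * Real.pi * ℓ / G) ^ 2 ≤ d ^ 2) :
    ∃ w : Fin (G + 1) → ℝ, (∀ i, 0 ≤ w i) ∧ ∑ i, w i = 1 ∧
      ∀ A, MeasurableSet A → |(P A).toReal - ∑ i, w i *
        ∫ z in A, shiftDensity (Finset.Icc (-(ℓ : ℤ)) ℓ) (rotZ θ ((i : ℕ) / G)) z ∂gaussSeq|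
          ≤ 3 * d := by
  have hPprob := hP.isProbabilityMeasure hg
  obtain ⟨Pp, hPp, hPA⟩ := hP
  have hgp := hg.1
  have hG0 : (0 : ℝ) < G := by exact_mod_cast hG
  set r : ℝ → Fin (G + 1) := fun φ => ⟨min ⌊φ * G⌋₊ G, by omega⟩ with hr
  have hrm : Measurable r := by
    have h1 : Measurable fun φ : ℝ => ⌊φ * G⌋₊ :=
      Nat.measurable_floor.comp (measurable_id.mul_const _)
    exact (measurable_from_top (f := fun n : ℕ => (⟨min n G, by omega⟩ : Fin (G + 1)))).comp h1
  have hclose : ∀ φ ∈ Set.Icc (0 : ℝ) 1, |φ - ((r φ : ℕ) : ℝ) / G| ≤ 1 / G := by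
    intro φ hφ
    have h0 : 0 ≤ φ * G := mul_nonneg hφ.1 hG0.le
    have hle : ⌊φ * G⌋₊ ≤ G := by
      have h1 : φ * G ≤ G := mul_le_of_le_one_left hG0.le hφ.2
      have h2 := Nat.floor_le_floor h1
      simpa using h2
    have hv : ((r φ : ℕ) : ℝ) = (⌊φ * G⌋₊ : ℝ) := by simp [hr, hle]
    have h3 := Nat.floor_le h0
    have h4 := Nat.lt_floor_add_one (φ * G)
    have h5 : φ - ((r φ : ℕ) : ℝ) / G = (φ * G - (⌊φ * G⌋₊ : ℝ)) / G := by
      rw [hv]; field_simp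
    rw [h5, abs_div, abs_of_pos hG0]
    gcongr
    rw [abs_le]; constructor <;> linarith
  refine ⟨fun i => (g (r ⁻¹' {i})).toReal, fun i => ENNReal.toReal_nonneg, ?_, fun A hA => ?_⟩
  · have hmap : IsProbabilityMeasure (g.map r) := Measure.isProbabilityMeasure_map hrm.aemeasurable
    have h1 : ∀ i, (g (r ⁻¹' {i})).toReal = (g.map r).real {i} := fun i => by
      rw [Measure.real, Measure.map_apply hrm (measurableSet_singleton i)]
    simp_rw [h1]
    rw [sum_measureReal_singleton]
    simp
  · set I := Finset.Icc (-(ℓ : ℤ)) ℓ with hI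
    set q : ℝ → ℝ := fun φ => ∫ z in A, shiftDensity I (rotZ θ φ) z ∂gaussSeq with hq
    have hq0 : ∀ φ, 0 ≤ q φ := fun φ => setIntegral_shiftDensity_nonneg _ _ _
    have hqclose : ∀ φ ∈ Set.Icc (0 : ℝ) 1, |q φ - q ((r φ : ℕ) / G)| ≤ 3 * d := by
      intro φ hφ
      refine abs_setIntegral_shiftDensity_sub_le I _ _ hd ?_ A
      refine le_trans ?_ hBd
      calc _ ≤ ∑ k ∈ I, ‖θ k‖ ^ 2 * (2 * Real.pi * ℓ / G) ^ 2 := by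
            refine Finset.sum_le_sum fun k hk => (norm_rotZ_sub_rotZ_sq_le _ _ _ _).trans ?_
            refine mul_le_mul_of_nonneg_left (sq_le_sq.2 ?_) (by positivity)
            rw [abs_of_nonneg (by positivity : 0 ≤ 2 * Real.pi * ℓ / G), abs_mul, abs_mul,
              abs_of_pos Real.two_pi_pos, div_eq_mul_one_div (2 * Real.pi * ℓ)]
            have hk' : |(k : ℝ)| ≤ ℓ := by exact_mod_cast abs_le.2 (Finset.mem_Icc.1 hk)
            have := hclose φ hφ
            gcongr
        _ ≤ _ := by rw [← Finset.sum_mul]; gcongr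
    have hPq : P A = ∫⁻ φ, ENNReal.ofReal (q φ) ∂g := by
      rw [hPA A hA]
      exact lintegral_congr fun φ => (hPp φ).apply_eq I hθ hA
    set S : ℝ := ∑ i : Fin (G + 1), (g (r ⁻¹' {i})).toReal * q ((i : ℕ) / G) with hS
    have hS0 : 0 ≤ S := Finset.sum_nonneg fun i _ => mul_nonneg ENNReal.toReal_nonneg (hq0 _)
    have hSq : ∫⁻ φ, ENNReal.ofReal (q ((r φ : ℕ) / G)) ∂g = ENNReal.ofReal S := by
      rw [← lintegral_map (f := fun i : Fin (G + 1) => ENNReal.ofReal (q ((i : ℕ) / G)))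
        measurable_from_top hrm, lintegral_fintype, hS,
        ENNReal.ofReal_sum_of_nonneg fun i _ => mul_nonneg ENNReal.toReal_nonneg (hq0 _)]
      refine Finset.sum_congr rfl fun i _ => ?_
      rw [Measure.map_apply hrm (measurableSet_singleton i), ENNReal.ofReal_mul
        ENNReal.toReal_nonneg, ENNReal.ofReal_toReal (measure_ne_top _ _), mul_comm]
    have hae : ∀ᵐ φ ∂g, φ ∈ Set.Icc (0 : ℝ) 1 :=
      (mem_ae_iff_prob_eq_one measurableSet_Icc).2 hg.2
    have h1 : P A ≤ ENNReal.ofReal (S + 3 * d) := by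
      rw [hPq, ENNReal.ofReal_add hS0 (by positivity), ← hSq]
      calc _ ≤ ∫⁻ φ, (ENNReal.ofReal (q ((r φ : ℕ) / G)) + ENNReal.ofReal (3 * d)) ∂g := by
            refine lintegral_mono_ae ?_
            filter_upwards [hae] with φ hφ
            rw [← ENNReal.ofReal_add (hq0 _) (by positivity)]
            exact ENNReal.ofReal_le_ofReal (by linarith [(abs_le.1 (hqclose φ hφ)).2])
        _ = _ := by rw [lintegral_add_right _ measurable_const]; simp
    have h2 : ENNReal.ofReal S ≤ P A + ENNReal.ofReal (3 * d) := by
      rw [hPq, ← hSq]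
      calc _ ≤ ∫⁻ φ, (ENNReal.ofReal (q φ) + ENNReal.ofReal (3 * d)) ∂g := by
            refine lintegral_mono_ae ?_
            filter_upwards [hae] with φ hφ
            rw [← ENNReal.ofReal_add (hq0 _) (by positivity)]
            exact ENNReal.ofReal_le_ofReal (by linarith [(abs_le.1 (hqclose φ hφ)).1])
        _ = _ := by rw [lintegral_add_right _ measurable_const]; simp
    have h3 : (P A).toReal ≤ S + 3 * d := ENNReal.toReal_le_of_le_ofReal (by positivity) h1
    have h4 : S ≤ (P A).toReal + 3 * d := by
      rw [← ENNReal.ofReal_toReal (measure_ne_top P A), ← ENNReal.ofReal_add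
        ENNReal.toReal_nonneg (by positivity)] at h2
      exact (ENNReal.ofReal_le_ofReal_iff (by positivity)).1 h2
    rw [abs_le]; constructor <;> linarith

/-- `P` is within `δ` in total variation of the mixture, with weights `v`, of the Gaussian laws
of `θ` rotated by the grid angles `a s / G`. -/
def IsNearGridMixture (ℓ G : ℕ) {n : ℕ} (θ : ℤ → ℂ) (a : Fin n → Fin (G + 1)) (v : Fin n → ℝ)
    (δ : ℝ) (P : Measure (ℤ → ℂ)) : Prop :=
  ∀ A, MeasurableSet A → |(P A).toReal - ∑ s, v s * ∫ z in A,
    shiftDensity (Finset.Icc (-(ℓ : ℤ)) ℓ) (rotZ θ ((a s : ℕ) / G)) z ∂gaussSeq| ≤ δ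

lemma exists_isNearGridMixture {θ : ℤ → ℂ} {g : Measure ℝ} {P : Measure (ℤ → ℂ)}
    (hP : IsMixtureLaw θ g P) (hg : IsProbOn01 g) {ℓ : ℕ}
    (hθ : ∀ k ∉ Finset.Icc (-(ℓ : ℤ)) ℓ, θ k = 0) {B : ℝ}
    (hB : ∑ k ∈ Finset.Icc (-(ℓ : ℤ)) ℓ, ‖θ k‖ ^ 2 ≤ B) {G : ℕ} (hG : 1 ≤ G) {d : ℝ} (hd : 0 < d)
    (hBd : B * (2 * Real.pi * ℓ / G) ^ 2 ≤ d ^ 2) {J : ℕ}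
    (hJ : 4 * Real.exp (Real.exp 1 * (2 * B) - J) ≤ d ^ 2) :
    ∃ (a : Fin (2 * (J * ℓ) + 3) → Fin (G + 1)) (v : Fin (2 * (J * ℓ) + 3) → ℝ),
      (∀ s, 0 ≤ v s) ∧ ∑ s, v s = 1 ∧ IsNearGridMixture ℓ G θ a v (4 * d) P := by
  obtain ⟨w, hw, hw1, hwP⟩ := exists_weights_on_grid hP hg hθ hB hG hd hBd
  obtain ⟨a, v, hv, hv1, hvw⟩ := exists_sparse_trig_weights
    (fun i : Fin (G + 1) => ((i : ℕ) : ℝ) / G) w hw hw1 (J * ℓ)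
  refine ⟨a, v, hv, hv1, fun A hA => ?_⟩
  have h1 := abs_sum_setIntegral_rotZ_le (Sum.elim w (fun s => -v s))
    (Sum.elim (fun i : Fin (G + 1) => ((i : ℕ) : ℝ) / G) (fun s => ((a s : ℕ) : ℝ) / G)) ℓ J
    (fun m hm τ => by simp [Fintype.sum_sum_type, hvw m hm τ])
    (by simp [Fintype.sum_sum_type, abs_of_nonneg, hw, hv, hw1, hv1]; norm_num)
    θ hd (by linarith : _ ≤ 2 * B) hJ A
  have h2 := hwP A hA
  simp only [Fintype.sum_sum_type, Sum.elim_inl, Sum.elim_inr, neg_mul,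
    Finset.sum_neg_distrib] at h1
  rw [abs_le] at h1 h2 ⊢
  constructor <;> linarith [h1.1, h1.2, h2.1, h2.2]

lemma dTV_le_of_isNearGridMixture {ℓ G n : ℕ} {θ η : ℤ → ℂ} {a : Fin n → Fin (G + 1)}
    {v u : Fin n → ℝ} {δ d τ : ℝ} {P Q : Measure (ℤ → ℂ)}
    (hP : IsNearGridMixture ℓ G θ a v δ P) (hQ : IsNearGridMixture ℓ G η a u δ Q)
    (hu : ∀ s, 0 ≤ u s) (hu1 : ∑ s, u s = 1) (hvu : ∑ s, |v s - u s| ≤ τ) (hd : 0 < d)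
    (hθη : ∑ k ∈ Finset.Icc (-(ℓ : ℤ)) ℓ, ‖θ k - η k‖ ^ 2 ≤ d ^ 2) :
    dTV P Q ≤ 2 * δ + τ + 3 * d := by
  have hδ : 0 ≤ δ := (abs_nonneg _).trans (hP _ .univ)
  have hτ : 0 ≤ τ := (Finset.sum_nonneg fun _ _ => abs_nonneg _).trans hvu
  unfold dTV
  refine Real.iSup_le (fun A => Real.iSup_le (fun hA => ?_) (by positivity)) (by positivity)
  set p : Fin n → ℝ := fun s => ∫ z in A,
    shiftDensity (Finset.Icc (-(ℓ : ℤ)) ℓ) (rotZ θ ((a s : ℕ) / G)) z ∂gaussSeq with hp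
  set q : Fin n → ℝ := fun s => ∫ z in A,
    shiftDensity (Finset.Icc (-(ℓ : ℤ)) ℓ) (rotZ η ((a s : ℕ) / G)) z ∂gaussSeq with hq
  have h1 : |(P A).toReal - ∑ s, v s * p s| ≤ δ := hP A hA
  have h2 : |(Q A).toReal - ∑ s, u s * q s| ≤ δ := hQ A hA
  have h3 : |∑ s, v s * p s - ∑ s, u s * q s| ≤ τ + 3 * d := by
    have e : ∑ s, v s * p s - ∑ s, u s * q s =
        ∑ s, (v s - u s) * p s + ∑ s, u s * (p s - q s) := by
      rw [← Finset.sum_sub_distrib, ← Finset.sum_add_distrib]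
      exact Finset.sum_congr rfl fun s _ => by ring
    rw [e]
    refine (abs_add_le _ _).trans (add_le_add (le_trans ?_ hvu) ?_)
    · refine (Finset.abs_sum_le_sum_abs _ _).trans (Finset.sum_le_sum fun s _ => ?_)
      rw [abs_mul, abs_of_nonneg (setIntegral_shiftDensity_nonneg _ _ A : 0 ≤ p s)]
      exact mul_le_of_le_one_right (abs_nonneg _) (setIntegral_shiftDensity_le_one _ _ _)
    · calc _ ≤ ∑ s, u s * (3 * d) := by
            refine (Finset.abs_sum_le_sum_abs _ _).trans (Finset.sum_le_sum fun s _ => ?_)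
            rw [abs_mul, abs_of_nonneg (hu s)]
            refine mul_le_mul_of_nonneg_left ?_ (hu s)
            refine abs_setIntegral_shiftDensity_sub_le _ _ _ hd ?_ A
            simpa only [norm_rotZ_sub_rotZ] using hθη
        _ = 3 * d := by rw [← Finset.sum_mul, hu1, one_mul]
  rw [abs_le] at h1 h2 h3 ⊢
  constructor <;> linarith [h1.1, h1.2, h2.1, h2.2, h3.1, h3.2]

lemma exists_centers_of_codes {Y : Type*} [Fintype Y] [Nonempty Y] {X : Type*}
    [MeasurableSpace X] [Nonempty X] (Good : Y → Measure X → Prop) {ε : ℝ}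
    (hprob : ∀ y P, Good y P → IsProbabilityMeasure P)
    (hclose : ∀ y P Q, Good y P → Good y Q → dTV P Q ≤ ε) :
    ∃ ctr : Fin (Fintype.card Y) → Measure X, (∀ i, IsProbabilityMeasure (ctr i)) ∧
      ∀ y P, Good y P → ∃ i, dTV P (ctr i) ≤ ε := by
  classical
  let c : Y → Measure X := fun y =>
    if h : ∃ P, Good y P then h.choose else Measure.dirac (Classical.arbitrary X)
  refine ⟨fun i => c ((Fintype.equivFin Y).symm i), fun i => ?_, fun y P hP =>
    ⟨Fintype.equivFin Y y, ?_⟩⟩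
  · simp only [c]
    split_ifs with h
    · exact hprob _ _ h.choose_spec
    · infer_instance
  · have h : ∃ P, Good y P := ⟨P, hP⟩
    simp only [c, Equiv.symm_apply_apply, dif_pos h]
    exact hclose y _ _ hP h.choose_spec

lemma sum_norm_sq_le_of_l2norm_le {θ : ℤ → ℂ} {s : Finset ℤ} (hθ : ∀ k ∉ s, θ k = 0) {w : ℝ}
    (h : l2norm θ ≤ w) : ∑ k ∈ s, ‖θ k‖ ^ 2 ≤ w ^ 2 := by
  rw [l2norm, tsum_eq_sum fun k hk => by simp [hθ k hk]] at h
  exact (Real.sqrt_le_left ((Real.sqrt_nonneg _).trans h)).1 h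

lemma abs_sub_le_of_floor_div_eq {x y δ : ℝ} (hδ : 0 < δ) (h : ⌊x / δ⌋ = ⌊y / δ⌋) :
    |x - y| ≤ δ := by
  have h1 := Int.abs_sub_lt_one_of_floor_eq_floor h
  rw [← sub_div, abs_div, abs_of_pos hδ, div_lt_one hδ] at h1
  exact h1.le

lemma floor_div_mem_Icc {x R δ : ℝ} (hδ : 0 < δ) (hx : |x| ≤ R) {T : ℕ} (hT : R / δ + 1 ≤ T) :
    ⌊x / δ⌋ ∈ Finset.Icc (-(T : ℤ)) T := by
  have h1 : |x / δ| ≤ R / δ := by rw [abs_div, abs_of_pos hδ]; gcongr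
  rw [abs_le] at h1
  rw [Finset.mem_Icc]
  constructor
  · rw [Int.le_floor]; push_cast; linarith [h1.1]
  · rw [Int.floor_le_iff]; push_cast; linarith [h1.2]

/-- codes of grid mixtures: rounded `θ`, rounded weights, and grid angles -/
abbrev GridCode (ℓ G n T : ℕ) : Type :=
  (Finset.Icc (-(ℓ : ℤ)) ℓ → Finset.Icc (-(T : ℤ)) T × Finset.Icc (-(T : ℤ)) T) ×
    (Fin n → Finset.Icc (-(T : ℤ)) T) × (Fin n → Fin (G + 1))

lemma card_gridCode (ℓ G n T : ℕ) : Fintype.card (GridCode ℓ G n T) =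
    (2 * T + 1) ^ (2 * (2 * ℓ + 1) + n) * (G + 1) ^ n := by
  have h : ∀ T : ℕ, Fintype.card (Finset.Icc (-(T : ℤ)) T) = 2 * T + 1 := fun T => by
    rw [Fintype.card_coe, Int.card_Icc]; omega
  simp only [GridCode, Fintype.card_prod, Fintype.card_fun, h, Fintype.card_fin]
  rw [← pow_two, ← pow_mul, ← mul_assoc, ← pow_add]

/-- `P` is a probability measure close to a grid mixture with code `y` at resolution `δ` -/
def HasGridCode {ℓ G n T : ℕ} (δ d : ℝ) (y : GridCode ℓ G n T) (P : Measure (ℤ → ℂ)) : Prop :=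
  IsProbabilityMeasure P ∧ ∃ (θ : ℤ → ℂ) (v : Fin n → ℝ), (∀ s, 0 ≤ v s) ∧ ∑ s, v s = 1 ∧
    IsNearGridMixture ℓ G θ y.2.2 v d P ∧
    (∀ k : Finset.Icc (-(ℓ : ℤ)) ℓ, ⌊(θ k).re / δ⌋ = (y.1 k).1 ∧ ⌊(θ k).im / δ⌋ = (y.1 k).2) ∧
    ∀ s, ⌊v s / δ⌋ = y.2.1 s

lemma dTV_le_of_hasGridCode {ℓ G n T : ℕ} {δ d ε : ℝ} (hδ : 0 < δ) (hℓ : 1 ≤ ℓ) (hn : 6 * ℓ ≤ n)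
    (hε : 2 * d + 4 * (n * δ) ≤ ε) {y : GridCode ℓ G n T} {P Q : Measure (ℤ → ℂ)}
    (hP : HasGridCode δ d y P) (hQ : HasGridCode δ d y Q) : dTV P Q ≤ ε := by
  obtain ⟨-, θ, v, -, -, hPm, hθ, hvy⟩ := hP
  obtain ⟨-, η, u, hu, hu1, hQm, hη, huy⟩ := hQ
  have hℓ' : (1 : ℝ) ≤ ℓ := by exact_mod_cast hℓ
  have hn' : 6 * (ℓ : ℝ) ≤ n := by exact_mod_cast hn
  have hn0 : (0 : ℝ) < n := by linarith
  refine (dTV_le_of_isNearGridMixture (τ := n * δ) (d := n * δ) hPm hQm hu hu1 ?_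
    (by positivity) ?_).trans (by linarith)
  · calc ∑ s, |v s - u s| ≤ ∑ _s : Fin n, δ := Finset.sum_le_sum fun s _ =>
          abs_sub_le_of_floor_div_eq hδ ((hvy s).trans (huy s).symm)
      _ = n * δ := by simp
  · calc ∑ k ∈ Finset.Icc (-(ℓ : ℤ)) ℓ, ‖θ k - η k‖ ^ 2
        ≤ ∑ _k ∈ Finset.Icc (-(ℓ : ℤ)) ℓ, (2 * δ ^ 2) := by
          refine Finset.sum_le_sum fun k hk => ?_
          have h1 := hθ ⟨k, hk⟩
          have h2 := hη ⟨k, hk⟩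
          have hre := abs_sub_le_of_floor_div_eq hδ (h1.1.trans h2.1.symm)
          have him := abs_sub_le_of_floor_div_eq hδ (h1.2.trans h2.2.symm)
          rw [← Complex.normSq_eq_norm_sq, Complex.normSq_apply, Complex.sub_re, Complex.sub_im]
          nlinarith [sq_le_sq' (abs_le.1 hre).1 (abs_le.1 hre).2,
            sq_le_sq' (abs_le.1 him).1 (abs_le.1 him).2]
      _ = (2 * ℓ + 1) * (2 * δ ^ 2) := by
          rw [Finset.sum_const, Int.card_Icc, nsmul_eq_mul,
            show ((ℓ : ℤ) + 1 - -(ℓ : ℤ)).toNat = 2 * ℓ + 1 by omega]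
          push_cast; ring
      _ ≤ n ^ 2 * δ ^ 2 := by
          have : (2 * ℓ + 1) * 2 ≤ (n : ℝ) ^ 2 := by nlinarith
          nlinarith [sq_nonneg δ]
      _ = (n * δ) ^ 2 := by ring

lemma exists_hasGridCode {θ : ℤ → ℂ} {g : Measure ℝ} {P : Measure (ℤ → ℂ)}
    (hP : IsMixtureLaw θ g P) (hg : IsProbOn01 g) {ℓ : ℕ}
    (hθ : ∀ k ∉ Finset.Icc (-(ℓ : ℤ)) ℓ, θ k = 0) {B : ℝ}
    (hB : ∑ k ∈ Finset.Icc (-(ℓ : ℤ)) ℓ, ‖θ k‖ ^ 2 ≤ B) {G : ℕ} (hG : 1 ≤ G) {d : ℝ} (hd : 0 < d)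
    (hBd : B * (2 * Real.pi * ℓ / G) ^ 2 ≤ d ^ 2) {J : ℕ}
    (hJ : 4 * Real.exp (Real.exp 1 * (2 * B) - J) ≤ d ^ 2) {δ R : ℝ} (hδ : 0 < δ) (hR1 : 1 ≤ R)
    (hBR : B ≤ R ^ 2) {T : ℕ} (hT : R / δ + 1 ≤ T) :
    ∃ y : GridCode ℓ G (2 * (J * ℓ) + 3) T, HasGridCode δ (4 * d) y P := by
  obtain ⟨a, v, hv, hv1, hnear⟩ := exists_isNearGridMixture hP hg hθ hB hG hd hBd hJ
  have hθR : ∀ k ∈ Finset.Icc (-(ℓ : ℤ)) ℓ, ‖θ k‖ ≤ R := fun k hk => by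
    refine abs_le_of_sq_le_sq' ?_ (by linarith) |>.2
    exact ((Finset.single_le_sum (f := fun k => ‖θ k‖ ^ 2) (fun _ _ => by positivity) hk).trans
      hB).trans hBR
  have hvR : ∀ s, |v s| ≤ R := fun s => by
    rw [abs_of_nonneg (hv s)]
    refine le_trans ?_ hR1
    rw [← hv1]
    exact Finset.single_le_sum (fun s _ => hv s) (Finset.mem_univ s)
  exact ⟨⟨fun k => ⟨⟨_, floor_div_mem_Icc hδ ((Complex.abs_re_le_norm _).trans (hθR k k.2)) hT⟩,
    ⟨_, floor_div_mem_Icc hδ ((Complex.abs_im_le_norm _).trans (hθR k k.2)) hT⟩⟩,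
    fun s => ⟨_, floor_div_mem_Icc hδ (hvR s) hT⟩, a⟩, hP.isProbabilityMeasure hg, θ, v, hv, hv1,
    hnear, fun k => ⟨rfl, rfl⟩, fun s => rfl⟩

lemma log_le_of_le_mul_pow_div {x D ε : ℝ} {ℓ : ℕ} (hx : 0 < x) (hD : 1 ≤ D) (hε : 0 < ε)
    (hε1 : ε ≤ 1) (hℓ : 1 ≤ ℓ) (h : x ≤ D * ((ℓ : ℝ) ^ 3 / ε)) :
    Real.log x ≤ (Real.log D / Real.log 2 + 3) * (Real.log (1 / ε) + Real.log ((ℓ : ℝ) + 1)) := by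
  have hℓ' : (1 : ℝ) ≤ ℓ := by exact_mod_cast hℓ
  have hl2 : 0 < Real.log 2 := Real.log_pos one_lt_two
  have h1 : 0 ≤ Real.log (1 / ε) := Real.log_nonneg (by rw [le_div_iff₀ hε]; linarith)
  have h2 : Real.log 2 ≤ Real.log ((ℓ : ℝ) + 1) := Real.log_le_log two_pos (by linarith)
  have h3 : Real.log ℓ ≤ Real.log ((ℓ : ℝ) + 1) := Real.log_le_log (by linarith) (by linarith)
  have h4 : Real.log D ≤
      Real.log D / Real.log 2 * (Real.log (1 / ε) + Real.log ((ℓ : ℝ) + 1)) := by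
    rw [div_mul_eq_mul_div, le_div_iff₀ hl2]
    exact mul_le_mul_of_nonneg_left (by linarith) (Real.log_nonneg hD)
  have h5 : Real.log x ≤ Real.log D + (3 * Real.log ℓ + Real.log (1 / ε)) := by
    refine (Real.log_le_log hx h).trans_eq ?_
    rw [div_eq_mul_one_div, Real.log_mul (by positivity) (by positivity),
      Real.log_mul (by positivity) (by positivity), Real.log_pow]
    push_cast; ring
  rw [add_mul]
  linarith

lemma energy_mul_mesh_sq_le {a L G ε : ℝ} (ha : 0 < a) (hL : 0 < L) (hL1 : 1 ≤ L) (hG : 0 < G)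
    (hε : 0 < ε) (h : 256 * a * L ^ 2 / ε ≤ G) :
    a ^ 2 * L * (2 * Real.pi * L / G) ^ 2 ≤ (ε / 32) ^ 2 := by
  rw [div_le_iff₀ hε] at h
  have h1 : a * L * (2 * Real.pi * L / G) ≤ ε / 32 := by
    rw [mul_div_assoc', div_le_iff₀ hG]
    have h2 : Real.pi * (a * L ^ 2) ≤ 4 * (a * L ^ 2) :=
      mul_le_mul_of_nonneg_right Real.pi_le_four (by positivity)
    calc a * L * (2 * Real.pi * L) = 2 * (Real.pi * (a * L ^ 2)) := by ring
      _ ≤ 2 * (4 * (a * L ^ 2)) := by linarith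
      _ = 256 * a * L ^ 2 / 32 := by ring
      _ ≤ G * ε / 32 := by linarith
      _ = ε / 32 * G := by ring
  have h3 : 0 ≤ a * L * (2 * Real.pi * L / G) := by have := Real.pi_pos; positivity
  calc _ ≤ L * (a ^ 2 * L * (2 * Real.pi * L / G) ^ 2) :=
        le_mul_of_one_le_left (by positivity) hL1
    _ = (a * L * (2 * Real.pi * L / G)) ^ 2 := by ring
    _ ≤ _ := pow_le_pow_left₀ h3 h1 2

lemma four_mul_exp_tail_le {a b κ L ε : ℝ} (hL : 1 ≤ L) (hε : 0 < ε)
    (hκ : 2 * Real.exp 1 * a ^ 2 + 2 * b + 9 ≤ κ) (h : Real.log (1 / ε) ≤ b * L) :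
    4 * Real.exp (Real.exp 1 * (2 * (a ^ 2 * L)) - κ * L) ≤ (ε / 32) ^ 2 := by
  have h1 : Real.exp 1 * (2 * (a ^ 2 * L)) - κ * L ≤ 2 * Real.log ε - 9 := by
    rw [one_div, Real.log_inv] at h
    have h5 := mul_le_mul_of_nonneg_right hκ (by linarith : 0 ≤ L)
    linarith
  have h2 : Real.exp (2 * Real.log ε - 9) = ε ^ 2 * Real.exp (-9) := by
    rw [sub_eq_add_neg, Real.exp_add, two_mul, Real.exp_add, Real.exp_log hε, sq]
  have h3 : Real.exp (-9) ≤ 1 / 4096 := by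
    rw [Real.exp_neg, one_div]
    refine inv_anti₀ (by norm_num) ?_
    have h4 : (2.7 : ℝ) ^ 9 ≤ Real.exp 1 ^ 9 := by
      gcongr
      linarith [Real.exp_one_gt_d9]
    rw [← Real.exp_nat_mul] at h4
    norm_num at h4
    linarith
  calc _ ≤ 4 * (ε ^ 2 * Real.exp (-9)) := by rw [← h2]; gcongr
    _ ≤ 4 * (ε ^ 2 * (1 / 4096)) := by gcongr
    _ = _ := by ring

lemma log_card_gridCode_le {ℓ G n T : ℕ} {D K ε : ℝ} (hD : 1 ≤ D) (hε : 0 < ε) (hε1 : ε ≤ 1)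
    (hℓ : 1 ≤ ℓ) (hn : 6 * ℓ ≤ n) (hnK : (n : ℝ) ≤ K * ℓ ^ 2)
    (hT : ((2 * T + 1 : ℕ) : ℝ) ≤ D * ((ℓ : ℝ) ^ 3 / ε))
    (hG : ((G + 1 : ℕ) : ℝ) ≤ D * ((ℓ : ℝ) ^ 3 / ε)) :
    Real.log (Fintype.card (GridCode ℓ G n T)) ≤ 3 * K * (Real.log D / Real.log 2 + 3) *
      (ℓ : ℝ) ^ 2 * (Real.log (1 / ε) + Real.log ((ℓ : ℝ) + 1)) := by
  have hℓ' : (1 : ℝ) ≤ ℓ := by exact_mod_cast hℓ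
  have hn' : 6 * (ℓ : ℝ) ≤ n := by exact_mod_cast hn
  have hl2 : 0 < Real.log 2 := Real.log_pos one_lt_two
  set c : ℝ := Real.log D / Real.log 2 + 3 with hc
  have hc0 : 0 < c := by
    have := Real.log_nonneg hD
    positivity
  set Λ : ℝ := Real.log (1 / ε) + Real.log ((ℓ : ℝ) + 1) with hΛ
  have hΛ0 : 0 ≤ Λ := add_nonneg
    (Real.log_nonneg (by rw [le_div_iff₀ hε]; linarith)) (Real.log_nonneg (by linarith))
  have hlT : Real.log ((2 * T + 1 : ℕ) : ℝ) ≤ c * Λ :=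
    log_le_of_le_mul_pow_div (by positivity) hD hε hε1 hℓ hT
  have hlG : Real.log ((G + 1 : ℕ) : ℝ) ≤ c * Λ :=
    log_le_of_le_mul_pow_div (by positivity) hD hε hε1 hℓ hG
  rw [card_gridCode, Nat.cast_mul, Nat.cast_pow, Nat.cast_pow,
    Real.log_mul (by positivity) (by positivity), Real.log_pow, Real.log_pow]
  calc _ ≤ ((2 * (2 * ℓ + 1) + n : ℕ) : ℝ) * (c * Λ) + n * (c * Λ) := by gcongr
    _ ≤ (2 * n) * (c * Λ) + n * (c * Λ) := by
        gcongr
        push_cast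
        linarith
    _ = 3 * n * (c * Λ) := by ring
    _ ≤ 3 * (K * ℓ ^ 2) * (c * Λ) := by gcongr
    _ = _ := by ring

/-- total variation ε-covering of the sieve
P_{ℓ,w} = {P_{θ,g} : θ supported in [−ℓ,ℓ], ‖θ‖ ≤ w, g ∈ 𝔐([0,1])} on ℂ^ℤ,
of log-cardinality at most C ℓ² (log(1/ε) + log(ℓ+1)), when log(1/ε) ≤ bℓ, w ≤ a√ℓ. -/
theorem covering_of_sieve_dTV :
    ∀ a b : ℝ, 0 < a → 0 < b →
      ∃ C : ℝ, 0 < C ∧ ∃ ε₀ ∈ Set.Ioo (0 : ℝ) 1, ∀ ε ∈ Set.Ioc (0 : ℝ) ε₀,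
        ∀ (ℓ : ℕ), 1 ≤ ℓ → Real.log (1 / ε) ≤ b * ℓ →
          ∀ w : ℝ, w ≤ a * Real.sqrt (ℓ : ℝ) →
            ∃ N : ℕ, 1 ≤ N ∧
              Real.log N ≤ C * (ℓ : ℝ) ^ 2 * (Real.log (1 / ε) + Real.log ((ℓ : ℝ) + 1)) ∧
              ∃ ctr : Fin N → Measure (ℤ → ℂ),
                (∀ i, IsProbabilityMeasure (ctr i)) ∧
                ∀ (θ : ℤ → ℂ), (∀ k : ℤ, (ℓ : ℤ) < |k| → θ k = 0) → l2norm θ ≤ w →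
                  ∀ g : Measure ℝ, IsProbOn01 g →
                    ∀ P : Measure (ℤ → ℂ), IsMixtureLaw θ g P →
                      ∃ i, dTV P (ctr i) ≤ ε := by
  intro a b ha hb
  obtain ⟨κ, hκ⟩ := exists_nat_ge (2 * Real.exp 1 * a ^ 2 + 2 * b + 9)
  have hκ9 : (9 : ℝ) ≤ κ := by
    have : 0 ≤ 2 * Real.exp 1 * a ^ 2 := by positivity
    linarith
  set D : ℝ := 32 * (a + 1) * (2 * κ + 3) + 256 * a + 5 with hDdef
  have hD0 : 0 ≤ 32 * (a + 1) * (2 * κ + 3) := by positivity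
  have hD : 1 ≤ D := by linarith
  have hl2 : 0 < Real.log 2 := Real.log_pos one_lt_two
  set c : ℝ := Real.log D / Real.log 2 + 3 with hc
  have hc0 : 0 < c := by
    have := Real.log_nonneg hD
    positivity
  refine ⟨3 * (2 * κ + 3) * c, by positivity, 1 / 2, by norm_num, ?_⟩
  rintro ε ⟨hε, hε2⟩ ℓ hℓ hεℓ w hw
  have hℓ' : (1 : ℝ) ≤ ℓ := by exact_mod_cast hℓ
  have hℓ0 : (0 : ℝ) < ℓ := by linarith
  set n : ℕ := 2 * (κ * ℓ * ℓ) + 3 with hn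
  have hnR : (n : ℝ) = 2 * κ * ℓ ^ 2 + 3 := by rw [hn]; push_cast; ring
  have hn0 : (0 : ℝ) < n := by rw [hnR]; positivity
  have hnle : (n : ℝ) ≤ (2 * κ + 3) * ℓ ^ 2 := by rw [hnR]; nlinarith
  have hn6' : 6 * (ℓ : ℝ) ≤ n := by rw [hnR]; nlinarith
  have hn6 : 6 * ℓ ≤ n := by exact_mod_cast hn6'
  set δ : ℝ := ε / (16 * n) with hδdef
  have hδ : 0 < δ := by positivity
  have hnδ : n * δ = ε / 16 := by rw [hδdef]; field_simp
  set R : ℝ := (a + 1) * ℓ with hR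
  set T : ℕ := ⌈R / δ + 1⌉₊ with hT
  set G : ℕ := ⌈256 * a * ℓ ^ 2 / ε⌉₊ + 1 with hG
  have hGR : 256 * a * ℓ ^ 2 / ε ≤ G := by
    rw [hG]; push_cast; linarith [Nat.le_ceil (256 * a * (ℓ : ℝ) ^ 2 / ε)]
  have hG0 : (0 : ℝ) < G := by rw [hG]; positivity
  have hne : Nonempty (GridCode ℓ G n T) := by
    have : Nonempty (Finset.Icc (-(T : ℤ)) T) := ⟨⟨0, by simp⟩⟩
    infer_instance
  obtain ⟨ctr, hctr, hcov⟩ := exists_centers_of_codes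
    (HasGridCode (ℓ := ℓ) (G := G) (n := n) (T := T) δ (4 * (ε / 32))) (ε := ε)
    (fun y P h => h.1)
    (fun y P Q hP hQ => dTV_le_of_hasGridCode hδ hℓ hn6 (by rw [hnδ]; linarith) hP hQ)
  refine ⟨_, Fintype.card_pos, ?_, ctr, hctr, ?_⟩
  · have hL : 1 ≤ (ℓ : ℝ) ^ 3 / ε := by
      rw [le_div_iff₀ hε]
      linarith [one_le_pow₀ hℓ' (n := 3)]
    have hTle : ((2 * T + 1 : ℕ) : ℝ) ≤ D * ((ℓ : ℝ) ^ 3 / ε) := by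
      have h1 : (T : ℝ) ≤ R / δ + 2 := by
        have := (Nat.ceil_lt_add_one (by positivity : 0 ≤ R / δ + 1)).le
        linarith
      have h2 : R / δ ≤ 16 * (a + 1) * (2 * κ + 3) * ((ℓ : ℝ) ^ 3 / ε) := by
        calc R / δ = 16 * (a + 1) * ℓ * n / ε := by rw [hδdef, hR]; field_simp
          _ ≤ 16 * (a + 1) * ℓ * ((2 * κ + 3) * ℓ ^ 2) / ε := by gcongr
          _ = _ := by ring
      have h3 : 0 ≤ 256 * a * ((ℓ : ℝ) ^ 3 / ε) := by positivity
      push_cast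
      rw [hDdef]
      nlinarith
    have hGle : ((G + 1 : ℕ) : ℝ) ≤ D * ((ℓ : ℝ) ^ 3 / ε) := by
      have h1 : (G : ℝ) ≤ 256 * a * ℓ ^ 2 / ε + 2 := by
        have := (Nat.ceil_lt_add_one (by positivity : 0 ≤ 256 * a * (ℓ : ℝ) ^ 2 / ε)).le
        rw [hG]; push_cast; linarith
      have h2 : 256 * a * ℓ ^ 2 / ε ≤ 256 * a * ((ℓ : ℝ) ^ 3 / ε) := by
        rw [mul_div_assoc]
        gcongr
        norm_num
      have h3 : 0 ≤ 32 * (a + 1) * (2 * κ + 3) * ((ℓ : ℝ) ^ 3 / ε) := by positivity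
      push_cast
      rw [hDdef]
      nlinarith
    exact log_card_gridCode_le hD hε (by linarith) hℓ hn6 hnle hTle hGle
  · intro θ hθ hθw g hg P hP
    have hθ' : ∀ k ∉ Finset.Icc (-(ℓ : ℤ)) ℓ, θ k = 0 := fun k hk =>
      hθ k (not_le.1 fun h => hk (Finset.mem_Icc.2 (abs_le.1 h)))
    have hB : ∑ k ∈ Finset.Icc (-(ℓ : ℤ)) ℓ, ‖θ k‖ ^ 2 ≤ a ^ 2 * ℓ := by
      refine (sum_norm_sq_le_of_l2norm_le hθ' (hθw.trans hw)).trans_eq ?_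
      rw [mul_pow, Real.sq_sqrt hℓ0.le]
    have hR1 : 1 ≤ R := by
      rw [hR]
      exact one_le_mul_of_one_le_of_one_le (by linarith) hℓ'
    have hBR : a ^ 2 * ℓ ≤ R ^ 2 := by
      rw [hR, mul_pow]
      gcongr
      · linarith
      · nlinarith
    have hJ := four_mul_exp_tail_le hℓ' hε hκ hεℓ
    rw [← Nat.cast_mul] at hJ
    obtain ⟨y, hy⟩ := exists_hasGridCode (G := G) (T := T) (J := κ * ℓ) (d := ε / 32) hP hg hθ' hB (by omega)
      (by positivity : 0 < ε / 32)
      (energy_mul_mesh_sq_le ha hℓ0 hℓ' hG0 hε hGR) hJ hδ hR1 hBR (Nat.le_ceil _)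
    exact hcov y P hy
end

section
/- For every a > 0 and b > 0 there exist constants C > 0 and ε₀ ∈ (0,1) such that the following holds. Let ε ∈ (0, ε₀], let ℓ ≥ 1 be an integer with log(1/ε) ≤ b ℓ, let θ ∈ ℂ^{2ℓ+1} satisfy ‖θ‖² ≤ a(2ℓ+1), let g⁰ be any Borel probability measure on [0,1], and let 0 < η ≤ ε². Then there exists a discrete probability measure g̃ on [0,1] whose support consists of at most C ℓ² points ψ_1, …, ψ_J satisfying |ψ_i − ψ_j| ≥ η for i ≠ j, such that d_H(P_{θ,g⁰}, P_{θ,g̃}) ≤ ( 1 + C (1 + ‖θ‖_{H1})^{1/2} ) ε. -/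
open MeasureTheory Real Set

/-- squared Euclidean (Hermitian) norm on ℂ^p -/
noncomputable def sqnorm (p : ℕ) (z : Fin p → ℂ) : ℝ := ∑ i, ‖z i‖ ^ 2

/-- density of the standard complex Gaussian on ℂ^p centered at μ,
with respect to Lebesgue measure on ℂ^p ≃ ℝ^{2p} -/
noncomputable def cgauss (p : ℕ) (μ z : Fin p → ℂ) : ℝ :=
  (Real.pi ^ p)⁻¹ * Real.exp (-sqnorm p (z - μ))

/-- the rotated vector θ•φ, coordinates indexed by k = i - ℓ ∈ {-ℓ,…,ℓ} -/
noncomputable def rot (ℓ : ℕ) (θ : Fin (2 * ℓ + 1) → ℂ) (φ : ℝ) : Fin (2 * ℓ + 1) → ℂ :=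
  fun i => θ i * Complex.exp (-Complex.I * (2 * Real.pi * (((i : ℤ) - (ℓ : ℤ) : ℤ) : ℝ) * φ))

/-- the H1 norm ‖θ‖_{H1} = (Σ_k k²|θ_k|²)^{1/2} -/
noncomputable def H1norm (ℓ : ℕ) (θ : Fin (2 * ℓ + 1) → ℂ) : ℝ :=
  Real.sqrt (∑ i : Fin (2 * ℓ + 1), ((((i : ℤ) - (ℓ : ℤ) : ℤ) : ℝ)) ^ 2 * ‖θ i‖ ^ 2)

/-- Hellinger distance between two (densities of) finite measures on ℂ^p -/
noncomputable def dHfin (p : ℕ) (q₁ q₂ : (Fin p → ℂ) → ℝ) : ℝ :=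
  Real.sqrt (∫ z, (Real.sqrt (q₁ z) - Real.sqrt (q₂ z)) ^ 2)

/-- density z ↦ ∫₀¹ γ(z − θ•φ) dg(φ) of the Gaussian mixture P_{θ,g} on ℂ^{2ℓ+1} -/
noncomputable def mixDensity (ℓ : ℕ) (θ : Fin (2 * ℓ + 1) → ℂ) (g : Measure ℝ)
    (z : Fin (2 * ℓ + 1) → ℂ) : ℝ :=
  ∫ φ, cgauss (2 * ℓ + 1) (rot ℓ θ φ) z ∂g

/-- the Gaussian mixture measure P_{θ,g} on ℂ^{2ℓ+1} -/
noncomputable def mixMeasure (ℓ : ℕ) (θ : Fin (2 * ℓ + 1) → ℂ) (g : Measure ℝ) :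
    Measure (Fin (2 * ℓ + 1) → ℂ) :=
  volume.withDensity (fun z => ENNReal.ofReal (mixDensity ℓ θ g z))

/-- In finite dimension, the convex hull of `s` consists of the convex combinations of
`finrank + 1` points of `s`. -/
theorem convexHull_eq_image_stdSimplex {E : Type*} [NormedAddCommGroup E] [NormedSpace ℝ E]
    [FiniteDimensional ℝ E] (s : Set E) :
    convexHull ℝ s =
      (fun q : (Fin (Module.finrank ℝ E + 1) → ℝ) × (Fin (Module.finrank ℝ E + 1) → E) =>
        ∑ i, q.1 i • q.2 i) '' (stdSimplex ℝ (Fin (Module.finrank ℝ E + 1)) ×ˢ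
          Set.univ.pi fun _ => s) := by
  apply Set.Subset.antisymm
  · intro x hx
    obtain ⟨s₀, hs₀⟩ : s.Nonempty := convexHull_nonempty_iff.mp ⟨x, hx⟩
    obtain ⟨ι, _, z, w, hz, hind, hw, hw1, hwx⟩ := eq_pos_convex_span_of_mem_convexHull hx
    have hcard : Fintype.card ι ≤ Fintype.card (Fin (Module.finrank ℝ E + 1)) := by
      rw [Fintype.card_fin]
      exact hind.card_le_finrank_succ.trans (by gcongr; exact Submodule.finrank_le _)
    obtain ⟨f⟩ := Function.Embedding.nonempty_of_card_le hcard
    have hf := f.injective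
    refine ⟨(Function.extend f w 0, Function.extend f z fun _ => s₀), ⟨⟨fun j => ?_, ?_⟩, ?_⟩, ?_⟩
    · by_cases h : ∃ i, f i = j
      · obtain ⟨i, rfl⟩ := h
        simpa [hf.extend_apply] using (hw i).le
      · simp [Function.extend_apply' _ _ _ h]
    · rw [← hw1]
      exact (Fintype.sum_of_injective f hf _ _
        (fun j hj => Function.extend_apply' w (0 : Fin (Module.finrank ℝ E + 1) → ℝ) j
          (by simpa using hj))
        fun i => (hf.extend_apply w 0 i).symm).symm
    · intro j _
      by_cases h : ∃ i, f i = j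
      · obtain ⟨i, rfl⟩ := h
        simpa [hf.extend_apply] using hz ⟨i, rfl⟩
      · simpa [Function.extend_apply' _ _ _ h] using hs₀
    · rw [← hwx]
      refine (Fintype.sum_of_injective f hf _ _ (fun j hj => ?_) fun i => ?_).symm
      · simp [Function.extend_apply' _ _ _ (show ¬ ∃ i, f i = j by simpa using hj)]
      · simp [hf.extend_apply]
  · rintro _ ⟨⟨w, z⟩, ⟨hw, hz⟩, rfl⟩
    exact (convex_convexHull ℝ s).sum_mem (fun i _ => hw.1 i) hw.2
      fun i _ => subset_convexHull ℝ s (hz i (Set.mem_univ i))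

theorem IsCompact.convexHull_of_finiteDimensional {E : Type*} [NormedAddCommGroup E]
    [NormedSpace ℝ E] [FiniteDimensional ℝ E] {s : Set E} (hs : IsCompact s) :
    IsCompact (convexHull ℝ s) := by
  rw [convexHull_eq_image_stdSimplex]
  refine ((isCompact_stdSimplex ℝ _).prod (isCompact_univ_pi fun _ => hs)).image ?_
  fun_prop

/-- The mean of a continuous vector-valued function over a probability measure on `[0,1]` is
attained by a discrete measure with at most `finrank + 1` atoms. -/
theorem exists_discrete_integral_eq {E : Type*} [NormedAddCommGroup E]
    [NormedSpace ℝ E] [FiniteDimensional ℝ E] {F : ℝ → E} (hF : Continuous F) {g : Measure ℝ}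
    (hg : IsProbOn01 g) :
    ∃ (ψ : Fin (Module.finrank ℝ E + 1) → ℝ) (p : Fin (Module.finrank ℝ E + 1) → ℝ),
      (∀ j, ψ j ∈ Set.Icc (0 : ℝ) 1) ∧ (∀ j, 0 ≤ p j) ∧ ∑ j, p j = 1 ∧
        Integrable F g ∧ ∫ φ, F φ ∂g = ∑ j, p j • F (ψ j) := by
  obtain ⟨_, hg1⟩ := hg
  have hae : ∀ᵐ φ ∂g, φ ∈ Set.Icc (0 : ℝ) 1 :=
    (mem_ae_iff_prob_eq_one measurableSet_Icc).mpr hg1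
  have hK : IsCompact (F '' Set.Icc (0 : ℝ) 1) := isCompact_Icc.image hF
  have hint : Integrable F g := by
    obtain ⟨B, hB⟩ := isCompact_Icc.exists_bound_of_continuousOn hF.continuousOn
    exact Integrable.of_bound hF.aestronglyMeasurable B (hae.mono hB)
  have hmem : ∫ φ, F φ ∂g ∈ convexHull ℝ (F '' Set.Icc (0 : ℝ) 1) :=
    (convex_convexHull ℝ _).integral_mem hK.convexHull_of_finiteDimensional.isClosed
      (hae.mono fun φ hφ => subset_convexHull ℝ _ ⟨φ, hφ, rfl⟩) hint
  rw [convexHull_eq_image_stdSimplex] at hmem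
  obtain ⟨⟨p, z⟩, ⟨hp, hz⟩, hpz⟩ := hmem
  choose ψ hψ hψz using fun j => hz j (Set.mem_univ j)
  exact ⟨ψ, p, hψ, hp.1, hp.2, hint, by simp [← hpz, hψz]⟩

/-- A finite set of reals has an `η`-separated subset whose `η`-neighbourhood covers it. -/
theorem Finset.exists_separated_subset (S : Finset ℝ) {η : ℝ} (hη : 0 < η) :
    ∃ T ⊆ S, (∀ s ∈ T, ∀ t ∈ T, s ≠ t → η ≤ |s - t|) ∧ ∀ s ∈ S, ∃ t ∈ T, |s - t| ≤ η := by
  induction S using Finset.induction with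
  | empty => exact ⟨∅, by simp⟩
  | insert a S _ ih =>
    obtain ⟨T, hTS, hsep, hcov⟩ := ih
    by_cases h : ∃ t ∈ T, |a - t| ≤ η
    · refine ⟨T, hTS.trans (Finset.subset_insert a S), hsep, fun s hs => ?_⟩
      rcases Finset.mem_insert.mp hs with rfl | hs
      exacts [h, hcov s hs]
    · push Not at h
      refine ⟨insert a T, Finset.insert_subset_insert a hTS, fun s hs t ht hst => ?_,
        fun s hs => ?_⟩
      · rcases Finset.mem_insert.mp hs with hsa | hs <;>
          rcases Finset.mem_insert.mp ht with hta | ht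
        · exact absurd (hsa.trans hta.symm) hst
        · exact hsa ▸ (h t ht).le
        · rw [abs_sub_comm]
          exact hta ▸ (h s hs).le
        · exact hsep s hs t ht hst
      · rcases Finset.mem_insert.mp hs with rfl | hs
        · exact ⟨s, Finset.mem_insert_self s T, by simpa using hη.le⟩
        · obtain ⟨t, ht, hst⟩ := hcov s hs
          exact ⟨t, Finset.mem_insert_of_mem ht, hst⟩

/-- The atoms of a discrete probability measure can be merged into `η`-separated ones,
each moving by at most `η`. -/
theorem exists_separated_merge {n : ℕ} (ψ p : Fin n → ℝ) (hψ : ∀ j, ψ j ∈ Set.Icc (0 : ℝ) 1)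
    (hp : ∀ j, 0 ≤ p j) (hp1 : ∑ j, p j = 1) {η : ℝ} (hη : 0 < η) :
    ∃ (J : ℕ) (χ q : Fin J → ℝ) (σ : Fin n → Fin J), J ≤ n ∧
      (∀ j, χ j ∈ Set.Icc (0 : ℝ) 1) ∧ (∀ i j, i ≠ j → η ≤ |χ i - χ j|) ∧
      (∀ j, 0 ≤ q j) ∧ ∑ j, q j = 1 ∧ (∀ i, |ψ i - χ (σ i)| ≤ η) ∧
      ∀ f : ℝ → ℝ, ∑ j, q j * f (χ j) = ∑ i, p i * f (χ (σ i)) := by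
  obtain ⟨T, hTS, hsep, hcov⟩ := (Finset.univ.image ψ).exists_separated_subset hη
  choose t ht htη using fun i => hcov (ψ i) (Finset.mem_image_of_mem ψ (Finset.mem_univ i))
  let e := T.equivFin
  have hsum : ∀ f : ℝ → ℝ, ∑ j, (∑ i with e ⟨t i, ht i⟩ = j, p i) * f (e.symm j) =
      ∑ i, p i * f (e.symm (e ⟨t i, ht i⟩)) := by
    intro f
    rw [← Finset.sum_fiberwise Finset.univ (fun i => e ⟨t i, ht i⟩)]
    refine Finset.sum_congr rfl fun j _ => ?_
    rw [Finset.sum_mul]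
    refine Finset.sum_congr rfl fun i hi => ?_
    rw [(Finset.mem_filter.mp hi).2]
  refine ⟨T.card, fun j => e.symm j, fun j => ∑ i with e ⟨t i, ht i⟩ = j, p i,
    fun i => e ⟨t i, ht i⟩, ?_, fun j => ?_, fun i j hij => ?_,
    fun j => Finset.sum_nonneg fun i _ => hp i, ?_, fun i => by simpa using htη i, hsum⟩
  · exact (Finset.card_le_card hTS).trans (Finset.card_image_le.trans (by simp))
  · obtain ⟨i, _, hi⟩ := Finset.mem_image.mp (hTS (e.symm j).2)
    exact hi.subst (motive := (· ∈ Set.Icc (0 : ℝ) 1)) (hψ i)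
  · exact hsep _ (e.symm i).2 _ (e.symm j).2
      fun h => hij (e.symm.injective (Subtype.ext h))
  · simpa [hp1] using hsum fun _ => 1

/-- The trigonometric polynomials of degree at most `M` and period `1`. -/
noncomputable def trigPoly (M : ℕ) : Submodule ℂ (ℝ → ℂ) :=
  Submodule.span ℂ ((fun (k : ℤ) (φ : ℝ) => Complex.exp (Complex.I * (2 * π * k * φ : ℝ))) ''
    Set.Icc (-(M : ℤ)) M)

theorem exp_mem_trigPoly {M : ℕ} {k : ℤ} (hk : k ∈ Set.Icc (-(M : ℤ)) M) :
    (fun φ : ℝ => Complex.exp (Complex.I * (2 * π * k * φ : ℝ))) ∈ trigPoly M :=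
  Submodule.subset_span ⟨k, hk, rfl⟩

theorem trigPoly_mono {M N : ℕ} (h : M ≤ N) : trigPoly M ≤ trigPoly N :=
  Submodule.span_mono (Set.image_mono (Set.Icc_subset_Icc (by simpa using h) (by simpa using h)))

theorem one_mem_trigPoly (M : ℕ) : (1 : ℝ → ℂ) ∈ trigPoly M := by
  convert exp_mem_trigPoly (M := M) (k := 0) ⟨by simp, by simp⟩
  simp

theorem mul_mem_trigPoly {M N : ℕ} {f g : ℝ → ℂ} (hf : f ∈ trigPoly M) (hg : g ∈ trigPoly N) :
    f * g ∈ trigPoly (M + N) := by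
  have h := Submodule.mul_mem_mul hf hg
  rw [trigPoly, trigPoly, Submodule.span_mul_span] at h
  refine Submodule.span_mono ?_ h
  rintro _ ⟨_, ⟨k, ⟨hk, hk'⟩, rfl⟩, _, ⟨m, ⟨hm, hm'⟩, rfl⟩, rfl⟩
  refine ⟨k + m, ⟨by push_cast; linarith, by push_cast; linarith⟩, ?_⟩
  ext φ
  simp only [Pi.mul_apply, ← Complex.exp_add]
  congr 1
  push_cast
  ring

theorem pow_mem_trigPoly {M : ℕ} {f : ℝ → ℂ} (hf : f ∈ trigPoly M) (r : ℕ) :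
    f ^ r ∈ trigPoly (r * M) := by
  induction r with
  | zero => simpa using one_mem_trigPoly 0
  | succ r ih =>
    rw [pow_succ, Nat.succ_mul]
    exact mul_mem_trigPoly ih hf

/-- A probability measure on `[0,1]` agrees on trigonometric polynomials of degree `M`
with a discrete one having at most `4 * M + 3` atoms. -/
theorem exists_discrete_trigPoly_integral_eq (M : ℕ) {g : Measure ℝ} (hg : IsProbOn01 g) :
    ∃ (ψ p : Fin (4 * M + 3) → ℝ),
      (∀ j, ψ j ∈ Set.Icc (0 : ℝ) 1) ∧ (∀ j, 0 ≤ p j) ∧ ∑ j, p j = 1 ∧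
        ∀ f ∈ trigPoly M, Integrable f g ∧ ∫ φ, f φ ∂g = ∑ j, (p j : ℂ) * f (ψ j) := by
  let F : ℝ → (Set.Icc (-(M : ℤ)) M → ℂ) :=
    fun φ k => Complex.exp (Complex.I * (2 * π * (k : ℤ) * φ : ℝ))
  have hF : Continuous F := by fun_prop
  have hd : Module.finrank ℝ (Set.Icc (-(M : ℤ)) M → ℂ) + 1 = 4 * M + 3 := by
    rw [Module.finrank_pi_fintype]
    simp only [Complex.finrank_real_complex, Finset.sum_const, Finset.card_univ,
      ← Set.toFinset_card, Set.toFinset_Icc, Int.card_Icc, smul_eq_mul]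
    omega
  have key := exists_discrete_integral_eq hF hg
  rw [hd] at key
  obtain ⟨ψ, p, hψ, hp, hp1, hint, heq⟩ := key
  refine ⟨ψ, p, hψ, hp, hp1, fun f hf => ?_⟩
  induction hf using Submodule.span_induction with
  | mem f hf =>
    obtain ⟨k, hk, rfl⟩ := hf
    have hk' := Integrable.eval hint
    refine ⟨hk' ⟨k, hk⟩, ?_⟩
    have h := congrFun heq ⟨k, hk⟩
    rw [eval_integral hk'] at h
    simpa [F] using h
  | zero => simp
  | add f f' _ _ hf hf' =>
    refine ⟨hf.1.add hf'.1, ?_⟩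
    simp only [Pi.add_apply]
    rw [integral_add hf.1 hf'.1, hf.2, hf'.2, ← Finset.sum_add_distrib]
    simp only [mul_add]
  | smul c f _ hf =>
    refine ⟨hf.1.smul c, ?_⟩
    simp only [Pi.smul_apply, smul_eq_mul]
    rw [integral_const_mul, hf.2, Finset.mul_sum]
    exact Finset.sum_congr rfl fun j _ => by ring

theorem sqnorm_nonneg (p : ℕ) (z : Fin p → ℂ) : 0 ≤ sqnorm p z :=
  Finset.sum_nonneg fun _ _ => by positivity

theorem cgauss_nonneg (p : ℕ) (μ z : Fin p → ℂ) : 0 ≤ cgauss p μ z := by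
  unfold cgauss
  positivity

theorem integral_exp_neg_mul_norm_sub_sq {c : ℝ} (hc : 0 < c) (m : ℂ) :
    ∫ w : ℂ, rexp (-c * ‖w - m‖ ^ 2) = π / c := by
  rw [integral_sub_right_eq_self (fun w : ℂ => rexp (-c * ‖w‖ ^ 2)) m,
    GaussianFourier.integral_rexp_neg_mul_sq_norm hc]
  simp

theorem exp_neg_mul_sqnorm_sub (p : ℕ) (c : ℝ) (μ z : Fin p → ℂ) :
    rexp (-c * sqnorm p (z - μ)) = ∏ i, rexp (-c * ‖z i - μ i‖ ^ 2) := by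
  rw [← Real.exp_sum, ← Finset.mul_sum]
  rfl

theorem integrable_exp_neg_mul_sqnorm_sub (p : ℕ) {c : ℝ} (hc : 0 < c) (μ : Fin p → ℂ) :
    Integrable fun z => rexp (-c * sqnorm p (z - μ)) := by
  simp only [exp_neg_mul_sqnorm_sub]
  refine Integrable.fintype_prod (f := fun i w => rexp (-c * ‖w - μ i‖ ^ 2)) fun i => ?_
  refine Integrable.of_integral_ne_zero ?_
  rw [integral_exp_neg_mul_norm_sub_sq hc]
  positivity

theorem integral_exp_neg_mul_sqnorm_sub (p : ℕ) {c : ℝ} (hc : 0 < c) (μ : Fin p → ℂ) :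
    ∫ z, rexp (-c * sqnorm p (z - μ)) = (π / c) ^ p := by
  simp only [exp_neg_mul_sqnorm_sub]
  rw [integral_fintype_prod_volume_eq_prod (fun i w => rexp (-c * ‖w - μ i‖ ^ 2))]
  simp only [integral_exp_neg_mul_norm_sub_sq hc, Finset.prod_const, Finset.card_univ,
    Fintype.card_fin]

theorem integrable_cgauss (p : ℕ) (μ : Fin p → ℂ) : Integrable (cgauss p μ) := by
  simpa using! (integrable_exp_neg_mul_sqnorm_sub p one_pos μ).const_mul (π ^ p)⁻¹

theorem integral_cgauss (p : ℕ) (μ : Fin p → ℂ) : ∫ z, cgauss p μ z = 1 := by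
  have h := integral_exp_neg_mul_sqnorm_sub p one_pos μ
  simp only [neg_mul, one_mul, div_one] at h
  simp only [cgauss]
  rw [integral_const_mul, h, inv_mul_cancel₀ (by positivity)]

/-- The parallelogram identity for the affinity of two Gaussian densities. -/
theorem sqrt_cgauss_mul_sqrt_cgauss (p : ℕ) (μ ν z : Fin p → ℂ) :
    √(cgauss p μ z) * √(cgauss p ν z) =
      rexp (-(sqnorm p (μ - ν) / 4)) * cgauss p ((1 / 2 : ℂ) • (μ + ν)) z := by
  have hs : sqnorm p (z - μ) + sqnorm p (z - ν) =
      2 * sqnorm p (z - (1 / 2 : ℂ) • (μ + ν)) + sqnorm p (μ - ν) / 2 := by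
    simp only [sqnorm, Finset.mul_sum, Finset.sum_div, ← Finset.sum_add_distrib]
    refine Finset.sum_congr rfl fun i _ => ?_
    simp only [Pi.sub_apply, Pi.smul_apply, Pi.add_apply, smul_eq_mul, ← Complex.normSq_eq_norm_sq,
      Complex.normSq_apply]
    simp
    ring
  rw [← Real.sqrt_mul (cgauss_nonneg p μ z), Real.sqrt_eq_iff_mul_self_eq
    (mul_nonneg (cgauss_nonneg p μ z) (cgauss_nonneg p ν z))
    (mul_nonneg (Real.exp_pos _).le (cgauss_nonneg _ _ _))]
  simp only [cgauss]
  have he : rexp (-sqnorm p (z - μ)) * rexp (-sqnorm p (z - ν)) =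
      (rexp (-(sqnorm p (μ - ν) / 4)) * rexp (-sqnorm p (z - (1 / 2 : ℂ) • (μ + ν)))) ^ 2 := by
    rw [← Real.exp_add, ← Real.exp_add, ← Real.exp_nat_mul]
    congr 1
    push_cast
    linarith
  linear_combination (π ^ p)⁻¹ ^ 2 * he

/-- Two Gaussian densities whose centers are at distance at most `d` are `3 d`-close in `L¹`. -/
theorem integral_abs_cgauss_sub_le (p : ℕ) {μ ν : Fin p → ℂ} {d : ℝ} (hd : 0 < d)
    (h : sqnorm p (μ - ν) ≤ d ^ 2) :
    ∫ z, |cgauss p μ z - cgauss p ν z| ≤ 3 * d := by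
  set E := rexp (-(sqnorm p (μ - ν) / 4)) with hE
  set m := (1 / 2 : ℂ) • (μ + ν) with hm
  have hE1 : 1 - d ^ 2 / 4 ≤ E := by
    have := Real.add_one_le_exp (-(sqnorm p (μ - ν) / 4))
    linarith
  have hle : ∀ z, |cgauss p μ z - cgauss p ν z| ≤
      (1 / (2 * d)) * (cgauss p μ z + cgauss p ν z - 2 * (E * cgauss p m z)) +
        d * (cgauss p μ z + cgauss p ν z) := by
    intro z
    rw [hE, hm, ← sqrt_cgauss_mul_sqrt_cgauss]
    have hA := Real.sq_sqrt (cgauss_nonneg p μ z)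
    have hB := Real.sq_sqrt (cgauss_nonneg p ν z)
    set A := √(cgauss p μ z)
    set B := √(cgauss p ν z)
    have hA0 : 0 ≤ A := Real.sqrt_nonneg _
    have hB0 : 0 ≤ B := Real.sqrt_nonneg _
    rw [← hA, ← hB]
    have h1 : |A ^ 2 - B ^ 2| = |A - B| * (A + B) := by
      rw [show A ^ 2 - B ^ 2 = (A - B) * (A + B) by ring, abs_mul, abs_of_nonneg (a := A + B)
        (by positivity)]
    have h2 : |A - B| * (A + B) ≤ 1 / (2 * d) * |A - B| ^ 2 + d / 2 * (A + B) ^ 2 := by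
      have : 1 / (2 * d) * |A - B| ^ 2 + d / 2 * (A + B) ^ 2 - |A - B| * (A + B) =
          1 / (2 * d) * (|A - B| - d * (A + B)) ^ 2 := by
        field_simp
        ring
      have h3 : 0 ≤ 1 / (2 * d) * (|A - B| - d * (A + B)) ^ 2 := by positivity
      linarith
    rw [sq_abs] at h2
    nlinarith [mul_nonneg hd.le (sq_nonneg (A - B))]
  have hi1 : Integrable fun z => cgauss p μ z + cgauss p ν z :=
    (integrable_cgauss p μ).add (integrable_cgauss p ν)
  have hi2 : Integrable fun z => 2 * (E * cgauss p m z) :=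
    ((integrable_cgauss p m).const_mul E).const_mul 2
  have hi3 : Integrable fun z => 1 / (2 * d) *
      (cgauss p μ z + cgauss p ν z - 2 * (E * cgauss p m z)) := (hi1.sub hi2).const_mul _
  calc ∫ z, |cgauss p μ z - cgauss p ν z|
      ≤ ∫ z, (1 / (2 * d)) * (cgauss p μ z + cgauss p ν z - 2 * (E * cgauss p m z)) +
          d * (cgauss p μ z + cgauss p ν z) :=
        integral_mono ((integrable_cgauss p μ).sub (integrable_cgauss p ν)).abs
          (hi3.add (hi1.const_mul _)) hle
    _ = (1 / (2 * d)) * (2 - 2 * E) + d * 2 := by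
        rw [integral_add hi3 (hi1.const_mul _), integral_const_mul,
          integral_const_mul, integral_sub hi1 hi2, integral_const_mul, integral_const_mul,
          integral_add (integrable_cgauss p μ) (integrable_cgauss p ν)]
        simp only [integral_cgauss]
        ring
    _ ≤ (1 / (2 * d)) * (d ^ 2 / 2) + d * 2 := by gcongr; linarith
    _ ≤ 3 * d := by
        have : 1 / (2 * d) * (d ^ 2 / 2) = d / 4 := by field_simp; ring
        linarith

/-- Geometric decay of the exponential series tail. -/
theorem norm_exp_sub_sum_le_exp (x : ℂ) (N : ℕ) :
    ‖Complex.exp x - ∑ m ∈ Finset.range N, x ^ m / (m.factorial : ℂ)‖ ≤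
      rexp (4 * ‖x‖ - N) := by
  refine (Complex.norm_exp_sub_sum_le_exp_norm_sub_sum x N).trans ?_
  set y := ‖x‖
  have hy : 0 ≤ y := norm_nonneg x
  have hs : ∀ t : ℝ, HasSum (fun m : ℕ => t ^ m / (m.factorial : ℝ)) (rexp t) := fun t => by
    simpa [Real.exp_eq_exp_ℝ] using NormedSpace.expSeries_div_hasSum_exp t
  have h1 : rexp y - ∑ m ∈ Finset.range N, y ^ m / (m.factorial : ℝ) =
      ∑' m, y ^ (m + N) / ((m + N).factorial : ℝ) := by
    rw [← (hs y).tsum_eq, ← (hs y).summable.sum_add_tsum_nat_add N]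
    ring
  have hs4 := (summable_nat_add_iff N).mpr (hs (rexp 1 * y)).summable
  have h2 : ∑' m, (rexp 1 * y) ^ (m + N) / ((m + N).factorial : ℝ) ≤ rexp (rexp 1 * y) := by
    rw [← (hs (rexp 1 * y)).tsum_eq, ← (hs (rexp 1 * y)).summable.sum_add_tsum_nat_add N]
    exact le_add_of_nonneg_left (Finset.sum_nonneg fun _ _ => by positivity)
  have h3 : ∑' m, y ^ (m + N) / ((m + N).factorial : ℝ) ≤
      ∑' m, rexp (-N) * ((rexp 1 * y) ^ (m + N) / ((m + N).factorial : ℝ)) := by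
    refine Summable.tsum_le_tsum (fun m => ?_) ((summable_nat_add_iff N).mpr (hs y).summable)
      (hs4.mul_left _)
    rw [mul_pow, mul_div_assoc, ← mul_assoc, ← Real.exp_nat_mul, ← Real.exp_add]
    refine le_mul_of_one_le_left (by positivity) (Real.one_le_exp ?_)
    push_cast
    have : (0 : ℝ) ≤ m := Nat.cast_nonneg m
    linarith
  rw [tsum_mul_left] at h3
  rw [h1]
  refine h3.trans ((mul_le_mul_of_nonneg_left h2 (Real.exp_pos _).le).trans ?_)
  rw [← Real.exp_add]
  have he : rexp 1 ≤ 4 := by linarith [Real.exp_one_lt_d9]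
  exact Real.exp_le_exp.mpr (by nlinarith)

theorem rot_eq (ℓ : ℕ) (θ : Fin (2 * ℓ + 1) → ℂ) (φ : ℝ) (i : Fin (2 * ℓ + 1)) :
    rot ℓ θ φ i = θ i * Complex.exp (Complex.I * (2 * π * (((ℓ : ℤ) - i : ℤ) : ℝ) * φ : ℝ)) := by
  simp only [rot]
  congr 2
  push_cast
  ring

theorem star_rot_eq (ℓ : ℕ) (θ : Fin (2 * ℓ + 1) → ℂ) (φ : ℝ) (i : Fin (2 * ℓ + 1)) :
    starRingEnd ℂ (rot ℓ θ φ i) = starRingEnd ℂ (θ i) *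
      Complex.exp (Complex.I * (2 * π * (((i : ℤ) - ℓ : ℤ) : ℝ) * φ : ℝ)) := by
  rw [rot_eq, map_mul, ← Complex.exp_conj, map_mul, Complex.conj_I, Complex.conj_ofReal]
  congr 2
  push_cast
  ring

theorem norm_rot (ℓ : ℕ) (θ : Fin (2 * ℓ + 1) → ℂ) (φ : ℝ) (i : Fin (2 * ℓ + 1)) :
    ‖rot ℓ θ φ i‖ = ‖θ i‖ := by
  rw [rot_eq, norm_mul, Complex.norm_exp_I_mul_ofReal, mul_one]

theorem sqnorm_rot_sub_le (ℓ : ℕ) (θ : Fin (2 * ℓ + 1) → ℂ) (φ χ : ℝ) :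
    sqnorm (2 * ℓ + 1) (rot ℓ θ φ - rot ℓ θ χ) ≤ (2 * π * H1norm ℓ θ * |φ - χ|) ^ 2 := by
  rw [mul_pow, mul_pow, H1norm, Real.sq_sqrt (Finset.sum_nonneg fun _ _ => by positivity), sq_abs,
    Finset.mul_sum, Finset.sum_mul, sqnorm]
  refine Finset.sum_le_sum fun i _ => ?_
  set x : ℝ := 2 * π * (((ℓ : ℤ) - i : ℤ) : ℝ)
  have h : ‖(rot ℓ θ φ - rot ℓ θ χ) i‖ ≤ ‖θ i‖ * |x * (φ - χ)| := by
    have he : (rot ℓ θ φ - rot ℓ θ χ) i = θ i * Complex.exp (Complex.I * (x * χ : ℝ)) *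
        (Complex.exp (Complex.I * (x * (φ - χ) : ℝ)) - 1) := by
      have hφ : Complex.exp (Complex.I * (x * φ : ℝ)) = Complex.exp (Complex.I * (x * χ : ℝ)) *
          Complex.exp (Complex.I * (x * (φ - χ) : ℝ)) := by
        rw [← Complex.exp_add]
        congr 1
        push_cast
        ring
      rw [Pi.sub_apply, rot_eq, rot_eq, hφ]
      ring
    rw [he, norm_mul, norm_mul, Complex.norm_exp_I_mul_ofReal, mul_one]
    gcongr
    exact Real.norm_exp_I_mul_ofReal_sub_one_le
  calc ‖(rot ℓ θ φ - rot ℓ θ χ) i‖ ^ 2 ≤ (‖θ i‖ * |x * (φ - χ)|) ^ 2 := by gcongr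
    _ = _ := by
      rw [mul_pow, sq_abs]
      simp only [x]
      push_cast
      ring

/-- The exponent `2 Re ⟨z, θ•φ⟩` of the likelihood ratio of `θ•φ` against `0`. -/
noncomputable def rotCorr (ℓ : ℕ) (θ z : Fin (2 * ℓ + 1) → ℂ) (φ : ℝ) : ℝ :=
  ∑ i, 2 * (starRingEnd ℂ (z i) * rot ℓ θ φ i).re

theorem rotCorr_mem_trigPoly (ℓ : ℕ) (θ z : Fin (2 * ℓ + 1) → ℂ) :
    (fun φ => (rotCorr ℓ θ z φ : ℂ)) ∈ trigPoly ℓ := by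
  have h : (fun φ => (rotCorr ℓ θ z φ : ℂ)) = ∑ i,
      ((starRingEnd ℂ (z i) * θ i) • (fun φ : ℝ =>
          Complex.exp (Complex.I * (2 * π * (((ℓ : ℤ) - i : ℤ) : ℝ) * φ : ℝ))) +
        (z i * starRingEnd ℂ (θ i)) • (fun φ : ℝ =>
          Complex.exp (Complex.I * (2 * π * (((i : ℤ) - ℓ : ℤ) : ℝ) * φ : ℝ)))) := by
    ext φ
    simp only [rotCorr, Finset.sum_apply, Pi.add_apply, Pi.smul_apply, smul_eq_mul,
      Complex.ofReal_sum]
    refine Finset.sum_congr rfl fun i _ => ?_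
    rw [← Complex.add_conj, map_mul, Complex.conj_conj, star_rot_eq, rot_eq]
    ring
  rw [h]
  refine Submodule.sum_mem _ fun i _ => Submodule.add_mem _ (Submodule.smul_mem _ _ ?_)
    (Submodule.smul_mem _ _ ?_)
  · exact exp_mem_trigPoly ⟨by omega, by omega⟩
  · exact exp_mem_trigPoly ⟨by omega, by omega⟩

theorem four_mul_abs_rotCorr_le (ℓ : ℕ) (θ z : Fin (2 * ℓ + 1) → ℂ) (φ : ℝ) :
    4 * |rotCorr ℓ θ z φ| ≤ sqnorm _ z / 2 + 32 * sqnorm _ θ := by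
  have h : |rotCorr ℓ θ z φ| ≤ ∑ i, 2 * (‖z i‖ * ‖θ i‖) := by
    refine (Finset.abs_sum_le_sum_abs _ _).trans (Finset.sum_le_sum fun i _ => ?_)
    rw [abs_mul, abs_two]
    gcongr
    refine (Complex.abs_re_le_norm _).trans ?_
    rw [norm_mul, Complex.norm_conj, norm_rot]
  refine (mul_le_mul_of_nonneg_left h (by norm_num)).trans ?_
  simp only [sqnorm, Finset.mul_sum, Finset.sum_div, ← Finset.sum_add_distrib]
  refine Finset.sum_le_sum fun i _ => ?_
  nlinarith [sq_nonneg (‖z i‖ - 8 * ‖θ i‖)]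

theorem cgauss_rot (ℓ : ℕ) (θ z : Fin (2 * ℓ + 1) → ℂ) (φ : ℝ) :
    cgauss (2 * ℓ + 1) (rot ℓ θ φ) z =
      (π ^ (2 * ℓ + 1))⁻¹ * rexp (-sqnorm _ z - sqnorm _ θ) * rexp (rotCorr ℓ θ z φ) := by
  rw [cgauss, mul_assoc, ← Real.exp_add]
  congr 2
  simp only [sqnorm, rotCorr, ← Finset.sum_neg_distrib, ← Finset.sum_add_distrib,
    ← Finset.sum_sub_distrib]
  refine Finset.sum_congr rfl fun i _ => ?_
  rw [← norm_rot ℓ θ φ i]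
  simp only [Pi.sub_apply, ← Complex.normSq_eq_norm_sq, Complex.normSq_apply]
  simp
  ring

theorem continuous_rotCorr (ℓ : ℕ) (θ z : Fin (2 * ℓ + 1) → ℂ) :
    Continuous (rotCorr ℓ θ z) := by
  unfold rotCorr rot
  fun_prop

/-- Pointwise comparison of two Gaussian mixtures whose mixing measures agree on trigonometric
polynomials of degree `N * ℓ`. -/
theorem abs_mixDensity_sub_le (ℓ N : ℕ) (θ : Fin (2 * ℓ + 1) → ℂ) {g : Measure ℝ}
    [IsProbabilityMeasure g] {n : ℕ} {ψ p : Fin n → ℝ} (hp : ∀ j, 0 ≤ p j) (hp1 : ∑ j, p j = 1)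
    (hmatch : ∀ f ∈ trigPoly (N * ℓ), Integrable f g ∧ ∫ φ, f φ ∂g = ∑ j, (p j : ℂ) * f (ψ j))
    (z : Fin (2 * ℓ + 1) → ℂ) :
    |mixDensity ℓ θ g z - ∑ j, p j * cgauss (2 * ℓ + 1) (rot ℓ θ (ψ j)) z| ≤
      2 * rexp (31 * sqnorm _ θ - N) *
        ((π ^ (2 * ℓ + 1))⁻¹ * rexp (-(1 / 2) * sqnorm _ (z - 0))) := by
  set G := (π ^ (2 * ℓ + 1))⁻¹ * rexp (-sqnorm _ z - sqnorm _ θ) with hG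
  have hG0 : 0 ≤ G := by positivity
  set S := rotCorr ℓ θ z with hS
  let T : ℝ → ℂ := fun φ => ∑ m ∈ Finset.range N, (S φ : ℂ) ^ m / (m.factorial : ℂ)
  let R : ℝ → ℂ := fun φ => Complex.exp (S φ) - T φ
  set B := rexp (sqnorm _ z / 2 + 32 * sqnorm _ θ - N) with hB
  have hR : ∀ φ, ‖R φ‖ ≤ B := fun φ => by
    refine (norm_exp_sub_sum_le_exp _ N).trans (Real.exp_le_exp.mpr ?_)
    rw [Complex.norm_real, Real.norm_eq_abs]
    linarith [four_mul_abs_rotCorr_le ℓ θ z φ]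
  have hTmem : T ∈ trigPoly (N * ℓ) := by
    have hT : T = ∑ m ∈ Finset.range N,
        ((m.factorial : ℂ)⁻¹) • (fun φ => (rotCorr ℓ θ z φ : ℂ)) ^ m := by
      ext φ
      simp only [T, hS, Finset.sum_apply, Pi.smul_apply, Pi.pow_apply, smul_eq_mul]
      exact Finset.sum_congr rfl fun m _ => by ring
    rw [hT]
    refine Submodule.sum_mem _ fun m hm => Submodule.smul_mem _ _ ?_
    exact trigPoly_mono (Nat.mul_le_mul_right ℓ (Finset.mem_range.mp hm).le)
      (pow_mem_trigPoly (rotCorr_mem_trigPoly ℓ θ z) m)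
  obtain ⟨hTint, hTeq⟩ := hmatch T hTmem
  have hScont : Continuous S := continuous_rotCorr ℓ θ z
  have hRint : Integrable R g :=
    Integrable.of_bound (by fun_prop) B (Filter.Eventually.of_forall hR)
  have hmix : ((mixDensity ℓ θ g z : ℝ) : ℂ) = G * ((∫ φ, R φ ∂g) + ∫ φ, T φ ∂g) := by
    rw [← integral_add hRint hTint, mixDensity, ← integral_const_mul, ← integral_complex_ofReal]
    refine integral_congr_ae (Filter.Eventually.of_forall fun φ => ?_)
    simp [cgauss_rot, R, hG, hS]
  have hsum : ((∑ j, p j * cgauss (2 * ℓ + 1) (rot ℓ θ (ψ j)) z : ℝ) : ℂ) =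
      G * (∑ j, (p j : ℂ) * R (ψ j) + ∑ j, (p j : ℂ) * T (ψ j)) := by
    rw [← Finset.sum_add_distrib, Finset.mul_sum, Complex.ofReal_sum]
    refine Finset.sum_congr rfl fun j _ => ?_
    simp only [cgauss_rot, R, ← hG, ← hS]
    push_cast
    ring
  have hdiff : ((mixDensity ℓ θ g z -
      ∑ j, p j * cgauss (2 * ℓ + 1) (rot ℓ θ (ψ j)) z : ℝ) : ℂ) =
      G * ((∫ φ, R φ ∂g) - ∑ j, (p j : ℂ) * R (ψ j)) := by
    rw [Complex.ofReal_sub, hmix, hsum, hTeq]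
    ring
  have hb1 : ‖∫ φ, R φ ∂g‖ ≤ B := by
    simpa using norm_integral_le_of_norm_le_const (μ := g) (Filter.Eventually.of_forall hR)
  have hb2 : ‖∑ j, (p j : ℂ) * R (ψ j)‖ ≤ B := by
    calc ‖∑ j, (p j : ℂ) * R (ψ j)‖ ≤ ∑ j, p j * B := by
          refine norm_sum_le_of_le _ fun j _ => ?_
          rw [norm_mul, Complex.norm_real, Real.norm_of_nonneg (hp j)]
          exact mul_le_mul_of_nonneg_left (hR _) (hp j)
      _ = B := by rw [← Finset.sum_mul, hp1, one_mul]
  rw [← Real.norm_eq_abs, ← Complex.norm_real, hdiff, norm_mul, Complex.norm_real,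
    Real.norm_of_nonneg hG0]
  calc G * ‖(∫ φ, R φ ∂g) - ∑ j, (p j : ℂ) * R (ψ j)‖ ≤ G * (B + B) := by
        gcongr
        exact (norm_sub_le _ _).trans (add_le_add hb1 hb2)
    _ = 2 * (π ^ (2 * ℓ + 1))⁻¹ * (rexp (-sqnorm _ z - sqnorm _ θ) * B) := by rw [hG]; ring
    _ = 2 * (π ^ (2 * ℓ + 1))⁻¹ *
        (rexp (31 * sqnorm _ θ - N) * rexp (-(1 / 2) * sqnorm _ (z - 0))) := by
        rw [hB, ← Real.exp_add, ← Real.exp_add, sub_zero]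
        congr 2
        ring
    _ = _ := by ring

theorem sq_sqrt_sub_sqrt_le {x y : ℝ} (hx : 0 ≤ x) (hy : 0 ≤ y) : (√x - √y) ^ 2 ≤ |x - y| := by
  have h : |x - y| = |√x - √y| * (√x + √y) := by
    rw [← abs_of_nonneg (add_nonneg (Real.sqrt_nonneg x) (Real.sqrt_nonneg y)), ← abs_mul]
    congr 1
    nlinarith [Real.sq_sqrt hx, Real.sq_sqrt hy]
  rw [h, ← sq_abs, sq]
  refine mul_le_mul_of_nonneg_left ?_ (abs_nonneg _)
  rw [abs_le]
  constructor <;> linarith [Real.sqrt_nonneg x, Real.sqrt_nonneg y]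

/-- Quantitative form: the squared Hellinger distance between a mixture and a discrete one obtained
by matching trigonometric moments and then moving every atom by at most `η`. -/
theorem integral_sq_sqrt_mixDensity_sub_le (ℓ N : ℕ) (θ : Fin (2 * ℓ + 1) → ℂ) {g : Measure ℝ}
    [IsProbabilityMeasure g] {n : ℕ} {ψ χ p : Fin n → ℝ} (hp : ∀ j, 0 ≤ p j) (hp1 : ∑ j, p j = 1)
    (hmatch : ∀ f ∈ trigPoly (N * ℓ), Integrable f g ∧ ∫ φ, f φ ∂g = ∑ j, (p j : ℂ) * f (ψ j))
    {η : ℝ} (hη : 0 < η) (hχ : ∀ j, |ψ j - χ j| ≤ η) :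
    ∫ z, (√(mixDensity ℓ θ g z) - √(∑ j, p j * cgauss (2 * ℓ + 1) (rot ℓ θ (χ j)) z)) ^ 2 ≤
      2 ^ (2 * ℓ + 2) * rexp (31 * sqnorm _ θ - N) + 6 * π * (1 + H1norm ℓ θ) * η := by
  have hH : 0 ≤ H1norm ℓ θ := Real.sqrt_nonneg _
  have hcint := integrable_exp_neg_mul_sqnorm_sub (2 * ℓ + 1) one_half_pos 0
  have hi1 : Integrable fun z => 2 * rexp (31 * sqnorm _ θ - N) *
      ((π ^ (2 * ℓ + 1))⁻¹ * rexp (-(1 / 2) * sqnorm (2 * ℓ + 1) (z - 0))) :=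
    (hcint.const_mul _).const_mul _
  have hi2 : ∀ j, Integrable fun z => p j * |cgauss (2 * ℓ + 1) (rot ℓ θ (ψ j)) z -
      cgauss (2 * ℓ + 1) (rot ℓ θ (χ j)) z| := fun j =>
    (((integrable_cgauss _ _).sub (integrable_cgauss _ _)).abs).const_mul _
  have hi3 := integrable_finsetSum Finset.univ fun j _ => hi2 j
  have hle : ∀ z, (√(mixDensity ℓ θ g z) -
      √(∑ j, p j * cgauss (2 * ℓ + 1) (rot ℓ θ (χ j)) z)) ^ 2 ≤
      2 * rexp (31 * sqnorm _ θ - N) *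
        ((π ^ (2 * ℓ + 1))⁻¹ * rexp (-(1 / 2) * sqnorm (2 * ℓ + 1) (z - 0))) +
      ∑ j, p j * |cgauss (2 * ℓ + 1) (rot ℓ θ (ψ j)) z -
        cgauss (2 * ℓ + 1) (rot ℓ θ (χ j)) z| := by
    intro z
    refine (sq_sqrt_sub_sqrt_le (integral_nonneg fun φ => cgauss_nonneg _ _ _)
      (Finset.sum_nonneg fun j _ => mul_nonneg (hp j) (cgauss_nonneg _ _ _))).trans ?_
    refine (abs_sub_le _ (∑ j, p j * cgauss (2 * ℓ + 1) (rot ℓ θ (ψ j)) z) _).trans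
      (add_le_add (abs_mixDensity_sub_le ℓ N θ hp hp1 hmatch z) ?_)
    rw [← Finset.sum_sub_distrib]
    refine (Finset.abs_sum_le_sum_abs _ _).trans (Finset.sum_le_sum fun j _ => ?_)
    rw [← mul_sub, abs_mul, abs_of_nonneg (hp j)]
  have hmove : ∀ j, ∫ z, |cgauss (2 * ℓ + 1) (rot ℓ θ (ψ j)) z -
      cgauss (2 * ℓ + 1) (rot ℓ θ (χ j)) z| ≤ 6 * π * (1 + H1norm ℓ θ) * η := by
    intro j
    refine (integral_abs_cgauss_sub_le _ (d := 2 * π * (1 + H1norm ℓ θ) * η)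
      (by positivity) ?_).trans_eq (by ring)
    refine (sqnorm_rot_sub_le ℓ θ (ψ j) (χ j)).trans ?_
    have := hχ j
    gcongr
    linarith
  refine (integral_mono_of_nonneg (Filter.Eventually.of_forall fun z => sq_nonneg _)
    (hi1.add hi3) (Filter.Eventually.of_forall hle)).trans ?_
  rw [integral_add' hi1 hi3, integral_const_mul, integral_const_mul,
    integral_exp_neg_mul_sqnorm_sub _ one_half_pos, integral_finsetSum _ fun j _ => hi2 j]
  refine add_le_add (le_of_eq ?_) ?_
  · rw [div_div_eq_mul_div, div_one, mul_pow, inv_mul_cancel_left₀ (by positivity)]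
    ring
  · calc ∑ j, ∫ z, p j * |cgauss (2 * ℓ + 1) (rot ℓ θ (ψ j)) z -
          cgauss (2 * ℓ + 1) (rot ℓ θ (χ j)) z|
        ≤ ∑ j, p j * (6 * π * (1 + H1norm ℓ θ) * η) := by
          refine Finset.sum_le_sum fun j _ => ?_
          rw [integral_const_mul]
          exact mul_le_mul_of_nonneg_left (hmove j) (hp j)
      _ = _ := by rw [← Finset.sum_mul, hp1, one_mul]

/-- approximation of an arbitrary mixing distribution g⁰ by a discrete
probability measure g̃ with at most Cℓ² η-separated support points, with
d_H(P_{θ,g⁰}, P_{θ,g̃}) ≤ (1 + C(1+‖θ‖_{H1})^{1/2}) ε. -/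
theorem finite_mixture_approximation :
    ∀ a b : ℝ, 0 < a → 0 < b →
      ∃ C : ℝ, 0 < C ∧ ∃ ε₀ ∈ Set.Ioo (0 : ℝ) 1, ∀ ε ∈ Set.Ioc (0 : ℝ) ε₀,
        ∀ (ℓ : ℕ), 1 ≤ ℓ → Real.log (1 / ε) ≤ b * ℓ →
          ∀ θ : Fin (2 * ℓ + 1) → ℂ, sqnorm (2 * ℓ + 1) θ ≤ a * (2 * (ℓ : ℝ) + 1) →
            ∀ g0 : Measure ℝ, IsProbOn01 g0 →
              ∀ η : ℝ, 0 < η → η ≤ ε ^ 2 →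
                ∃ (J : ℕ) (ψ : Fin J → ℝ) (p : Fin J → ℝ),
                  (J : ℝ) ≤ C * (ℓ : ℝ) ^ 2 ∧
                  (∀ j, ψ j ∈ Set.Icc (0 : ℝ) 1) ∧
                  (∀ i j, i ≠ j → η ≤ |ψ i - ψ j|) ∧
                  (∀ j, 0 ≤ p j) ∧ (∑ j, p j) = 1 ∧
                  dHfin (2 * ℓ + 1) (mixDensity ℓ θ g0)
                      (fun z => ∑ j, p j * cgauss (2 * ℓ + 1) (rot ℓ θ (ψ j)) z)
                    ≤ (1 + C * Real.sqrt (1 + H1norm ℓ θ)) * ε := by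
  intro a b ha hb
  set K : ℕ := ⌈2 * b + 93 * a + 4⌉₊ with hK
  have hKle : 2 * b + 93 * a + 4 ≤ K := Nat.le_ceil _
  refine ⟨4 * K + 5, by positivity, 1 / 2, by norm_num, ?_⟩
  rintro ε ⟨hε, -⟩ ℓ hℓ hlog θ hθ g0 hg0 η hη hηε
  have hℓ' : (1 : ℝ) ≤ ℓ := by exact_mod_cast hℓ
  obtain ⟨ψ, p, hψ, hp, hp1, hmatch⟩ := exists_discrete_trigPoly_integral_eq (ℓ * K * ℓ) hg0
  obtain ⟨J, χ, q, σ, hJ, hχ, hsep, hq, hq1, hσ, hsum⟩ :=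
    exists_separated_merge ψ p hψ hp hp1 hη
  refine ⟨J, χ, q, ?_, hχ, hsep, hq, hq1, ?_⟩
  · have hJ' : (J : ℝ) ≤ 4 * (ℓ * K * ℓ) + 3 := by exact_mod_cast hJ
    nlinarith
  have := hg0.1
  have hH : 0 ≤ H1norm ℓ θ := Real.sqrt_nonneg _
  have hbound := integral_sq_sqrt_mixDensity_sub_le ℓ (ℓ * K) θ hp hp1 hmatch hη hσ
  have hexp : 2 ^ (2 * ℓ + 2) * rexp (31 * sqnorm _ θ - (ℓ * K : ℕ)) ≤ ε ^ 2 := by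
    have h2 : (2 : ℝ) ^ (2 * ℓ + 2) ≤ rexp (2 * ℓ + 2) := by
      have h := pow_le_pow_left₀ zero_le_two (by linarith [Real.exp_one_gt_d9] : 2 ≤ rexp 1)
        (2 * ℓ + 2)
      rw [← Real.exp_nat_mul] at h
      simpa using h
    have hε2 : ε ^ 2 = rexp (-(2 * Real.log (1 / ε))) := by
      rw [one_div, Real.log_inv, mul_neg, neg_neg, mul_comm, Real.exp_mul, Real.exp_log hε]
      norm_cast
    refine (mul_le_mul_of_nonneg_right h2 (Real.exp_pos _).le).trans ?_
    rw [hε2, ← Real.exp_add]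
    refine Real.exp_le_exp.mpr ?_
    push_cast
    nlinarith [mul_le_mul_of_nonneg_left hKle (zero_le_one.trans hℓ')]
  have hmain : ∫ z, (√(mixDensity ℓ θ g0 z) -
      √(∑ j, q j * cgauss (2 * ℓ + 1) (rot ℓ θ (χ j)) z)) ^ 2 ≤
      (5 * √(1 + H1norm ℓ θ) * ε) ^ 2 := by
    simp only [fun z => hsum fun t => cgauss (2 * ℓ + 1) (rot ℓ θ t) z]
    refine hbound.trans ((add_le_add hexp (mul_le_mul_of_nonneg_left hηε (by positivity))).trans ?_)
    rw [mul_pow, mul_pow, Real.sq_sqrt (by positivity)]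
    have hπ := Real.pi_lt_four
    have h1 : ε ^ 2 ≤ (1 + H1norm ℓ θ) * ε ^ 2 := le_mul_of_one_le_left (sq_nonneg ε) (by linarith)
    have h2 : 6 * π * (1 + H1norm ℓ θ) * ε ^ 2 ≤ 24 * (1 + H1norm ℓ θ) * ε ^ 2 := by
      gcongr
      linarith
    linarith
  refine (Real.sqrt_le_iff.mpr ⟨by positivity, hmain⟩).trans ?_
  refine mul_le_mul_of_nonneg_right ?_ hε.le
  have h := mul_nonneg (by positivity : (0 : ℝ) ≤ 4 * K) (Real.sqrt_nonneg (1 + H1norm ℓ θ))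
  linarith
end
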